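/- arXiv:1108.5053 — 2 statements merged into one kernel-verified Lean document; each statement's English description precedes it below -/
import Mathlib

section
/- Let σ be a primitive substitution on the two-letter alphabet 𝒜 = {a,b}. Then every bi-infinite word u in the hull X_σ is Sturmian — i.e., for every n ≥ 1 the number of distinct factors of u of length n is exactly n+1 — if and only if σ is invertible, i.e., the extension of σ to the free group F₂ is an automorphism of F₂. -/
open scoped Matrix

/-- The two-letter alphabet `𝒜 = {a, b}`; the letter `a` is `0` and the letter `b` is `1`. -/
abbrev A2 := Fin 2

/-- A substitution on the two-letter alphabet, given by the images of the two letters.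
(The nonerasing condition is stated separately as `TwoSubst.NonErasing`.) -/
abbrev Subst := A2 → List A2

namespace TwoSubst

/-- A substitution is non-erasing if the images of the letters are nonempty words. -/
def NonErasing (σ : Subst) : Prop := ∀ i : A2, σ i ≠ []

/-- The extension of a substitution to finite words (the morphism of the free monoid). -/
def apply (σ : Subst) (w : List A2) : List A2 := w.flatMap σ

/-- The `n`-th power `σ^n` of a substitution (as a substitution). -/
def substPow (σ : Subst) (n : ℕ) : Subst := fun i => (apply σ)^[n] [i]

/-- Composition of substitutions: `(σ ∘ τ)(i) = σ(τ(i))`. -/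
def comp (σ τ : Subst) : Subst := fun i => apply σ (τ i)

/-- The substitution matrix `M_σ`: entry `(i, j)` is the number of occurrences of the
letter `i` in `σ(j)`. -/
def M (σ : Subst) : Matrix (Fin 2) (Fin 2) ℤ := fun i j => ((σ j).count i : ℤ)

/-- A substitution is primitive if some power of its substitution matrix has all
entries positive. -/
def Primitive (σ : Subst) : Prop := ∃ n : ℕ, 0 < n ∧ ∀ i j, 0 < (M σ ^ n) i j

/-- A finite word, regarded as an element of the free group `F₂`. -/
def toFG (w : List A2) : FreeGroup A2 := (w.map FreeGroup.of).prod

/-- The endomorphism of the free group `F₂` induced by a substitution. -/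
def endo (σ : Subst) : Monoid.End (FreeGroup A2) := FreeGroup.lift fun i => toFG (σ i)

/-- A substitution is invertible if its extension to the free group `F₂` is an
automorphism of `F₂`. -/
def IsInvertible (σ : Subst) : Prop := Function.Bijective (endo σ)

/-- Two substitutions are conjugate, `σ ~ ρ`, if `σ = γ_w ∘ ρ` as endomorphisms of `F₂`
for some `w ∈ F₂`, where `γ_w x = w * x * w⁻¹`. -/
def Conj (σ ρ : Subst) : Prop := ∃ w : FreeGroup A2, ∀ x, endo σ x = w * endo ρ x * w⁻¹

/-- `w` is a (finite) factor of the bi-infinite word `u : ℤ → A2`. -/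
def IsFactor (w : List A2) (u : ℤ → A2) : Prop :=
  ∃ k : ℤ, w = (List.range w.length).map fun i => u (k + i)

/-- The hull `X_σ`: the set of bi-infinite words all of whose finite factors appear as
factors of `σ^n(a)` or `σ^n(b)` for some `n ∈ ℕ`. -/
def Hull (σ : Subst) : Set (ℤ → A2) :=
  { u | ∀ w : List A2, IsFactor w u → ∃ (n : ℕ) (x : A2), w <:+: substPow σ n x }

/-- The substitution `E : a ↦ b, b ↦ a`. -/
def Esub : Subst := ![[1], [0]]

/-- The substitution `L : a ↦ a, b ↦ ab`. -/
def Lsub : Subst := ![[0], [0, 1]]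

/-- The composition `L^{a₁} ∘ E ∘ L^{a₂} ∘ E ∘ ⋯ ∘ E ∘ L^{a_m}` encoded by the
nonempty list of exponents `a₁ :: [a₂, …, a_m]`. -/
def chain : ℕ → List ℕ → Subst
  | a, [] => substPow Lsub a
  | a, b :: rest => comp (substPow Lsub a) (comp Esub (chain b rest))

/-- The letter-exchange map `a ↦ b, b ↦ a` on letters. -/
def swapA : A2 → A2 := fun i => if i = 0 then 1 else 0

/-- The substitution matrix with real entries. -/
noncomputable def Mreal (σ : Subst) : Matrix (Fin 2) (Fin 2) ℝ := (M σ).map fun z => (z : ℝ)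

/-- `lam` is the inflation factor (Perron–Frobenius eigenvalue) of `σ`: it is an
eigenvalue of `M_σ` admitting a positive eigenvector. -/
def IsInflation (σ : Subst) (lam : ℝ) : Prop :=
  ∃ v : Fin 2 → ℝ, (∀ i, 0 < v i) ∧ (Mreal σ).mulVec v = lam • v

/-- `α` is the frequency of `σ`: `α ∈ (0,1)` and `(1-α, α)` is an eigenvector of `M_σ`
for an eigenvalue with positive eigenvector (necessarily the Perron-Frobenius
eigenvalue, i.e. the inflation factor, when `σ` is primitive). -/
def IsFreq (σ : Subst) (α : ℝ) : Prop :=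
  0 < α ∧ α < 1 ∧ ∃ lam : ℝ, (Mreal σ).mulVec ![1 - α, α] = lam • ![1 - α, α]

/-- The automorphism `τ_a : a ↦ a⁻¹, b ↦ b` of the free group `F₂`. -/
def tauA : Monoid.End (FreeGroup A2) :=
  FreeGroup.lift fun i : A2 => if i = 0 then (FreeGroup.of (0 : A2))⁻¹ else FreeGroup.of 1

/-- `ρ` is the reciprocal substitution `σ̄ = τ_a ∘ σ⁻¹ ∘ τ_a⁻¹` of `σ`, where
`φ` is the inverse automorphism `σ⁻¹` (note `τ_a⁻¹ = τ_a`). -/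
def IsReciprocal (σ ρ : Subst) (φ : Monoid.End (FreeGroup A2)) : Prop :=
  (∀ x, φ (endo σ x) = x) ∧ (∀ x, endo σ (φ x) = x) ∧
    NonErasing ρ ∧ ∀ x, endo ρ x = tauA (φ (tauA x))

/-- `σ` is a selfdual substitution (relative to its reciprocal `ρ = σ̄`):
`σ ~ σ̄` or `σ ~ E ∘ σ̄ ∘ E`. -/
def SelfDual (σ ρ : Subst) : Prop :=
  Conj σ ρ ∨ Conj σ (comp Esub (comp ρ Esub))

/-! ### Strands and dual maps -/

/-- Integer vectors in the plane. -/
abbrev V2 := Fin 2 → ℤ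

/-- The abelianisation map `A : 𝒜* → ℤ²`, counting occurrences of each letter. -/
def Avec (w : List A2) : V2 := fun i => (w.count i : ℤ)

/-- The space `𝒢` (and its dual `𝒢*`): formal finite real linear combinations of the
basis elements `(W, i)` (resp. `(W, i*)`), `W ∈ ℤ²`, `i ∈ 𝒜`. -/
abbrev Gspace := (V2 × A2) →₀ ℝ

/-- The image of the basis element `(W, i)` under `E₁(σ)`. -/
noncomputable def E1Basis (σ : Subst) (p : V2 × A2) : Gspace :=
  ∑ k ∈ Finset.range (σ p.2).length,
    Finsupp.single ((M σ).mulVec p.1 + Avec ((σ p.2).take k), (σ p.2).getD k p.2) (1 : ℝ)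

/-- The one-dimensional extension `E₁(σ)`, as a linear map on `𝒢`. -/
noncomputable def E1 (σ : Subst) : Gspace →ₗ[ℝ] Gspace :=
  Finsupp.lift Gspace ℝ (V2 × A2) (E1Basis σ)

/-- The image of the basis element `(W, i*)` under the dual map `E₁*(σ)`:
`E₁*(σ)(W, i*) = Σ_{j,k : σ(j)_k = i} (M_σ⁻¹·(W + A(σ(j)_{k+1}⋯σ(j)_{|σ(j)|})), j*)`. -/
noncomputable def E1starBasis (σ : Subst) (p : V2 × A2) : Gspace :=
  ∑ j : A2, ∑ k ∈ Finset.range (σ j).length,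
    if (σ j).getD k j = p.2 then
      Finsupp.single ((M σ)⁻¹.mulVec (p.1 + Avec ((σ j).drop (k + 1))), j) (1 : ℝ)
    else 0

/-- The dual map `E₁*(σ)`, as a linear map on `𝒢*`. -/
noncomputable def E1star (σ : Subst) : Gspace →ₗ[ℝ] Gspace :=
  Finsupp.lift Gspace ℝ (V2 × A2) (E1starBasis σ)

/-- The basis vector `e_a = (1,0)`. -/
def ea : V2 := ![1, 0]

/-- The basis vector `e_b = (0,1)`. -/
def eb : V2 := ![0, 1]

/-- `γ(0), …, γ(n)` is a finite dual strand: each step is `e_a` or `-e_b`. -/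
def IsDualStrand (n : ℕ) (γ : ℕ → V2) : Prop :=
  ∀ k < n, γ (k + 1) - γ k = ea ∨ γ (k + 1) - γ k = -eb

/-- The element of `𝒢*` associated with a finite dual strand `γ(0), …, γ(n)`:
the sum of `(γ(k), b*)` over the `e_a`-steps and `(γ(k+1), a*)` over the `-e_b`-steps
(the letter `a` is `0`, the letter `b` is `1`). -/
noncomputable def strandElem (n : ℕ) (γ : ℕ → V2) : Gspace :=
  ∑ k ∈ Finset.range n,
    if γ (k + 1) - γ k = ea then Finsupp.single (γ k, (1 : A2)) (1 : ℝ)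
    else Finsupp.single (γ (k + 1), (0 : A2)) (1 : ℝ)

/-! ### Endomorphisms of the free group -/

/-- The exponent-sum homomorphism of the generator `i` on `F₂`. -/
def expSum (i : A2) : FreeGroup A2 →* Multiplicative ℤ :=
  FreeGroup.lift fun j : A2 => Multiplicative.ofAdd (if j = i then (1 : ℤ) else 0)

/-- The abelianised matrix of an endomorphism of `F₂`: entry `(i,j)` is the exponent
sum of the generator `i` in the image of the generator `j`. -/
def abelMatrix (σ : Monoid.End (FreeGroup A2)) : Matrix (Fin 2) (Fin 2) ℤ :=
  fun i j => Multiplicative.toAdd (expSum i (σ (FreeGroup.of j)))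

/-- `wprod ρ w k = w · ρ(w) · ρ²(w) ⋯ ρ^{k−1}(w)`. -/
def wprod (ρ : Monoid.End (FreeGroup A2)) (w : FreeGroup A2) : ℕ → FreeGroup A2
  | 0 => 1
  | k + 1 => wprod ρ w k * (ρ ^ k) w

end TwoSubst

namespace TwoSubst

/-! ### Nielsen normal form -/

def posW (w : List A2) : List (A2 × Bool) := w.map fun i => (i, true)
def negW (w : List A2) : List (A2 × Bool) := w.reverse.map fun i => (i, false)

theorem toFG_append (u v : List A2) : toFG (u ++ v) = toFG u * toFG v := by
  simp [toFG]

theorem toFG_eq (w : List A2) : toFG w = FreeGroup.mk (posW w) := by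
  induction w with
  | nil => rfl
  | cons a w ih =>
    have : toFG (a :: w) = FreeGroup.of a * toFG w := by simp [toFG]
    rw [this, ih]; rfl

theorem toFG_inv (w : List A2) : (toFG w)⁻¹ = FreeGroup.mk (negW w) := by
  rw [toFG_eq, FreeGroup.inv_mk]
  simp [FreeGroup.invRev, posW, negW, Function.comp_def]

theorem posW_append (u v : List A2) : posW (u ++ v) = posW u ++ posW v := by simp [posW]
theorem negW_append (u v : List A2) : negW (u ++ v) = negW v ++ negW u := by simp [negW]
@[simp] theorem posW_length (u : List A2) : (posW u).length = u.length := by simp [posW]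
@[simp] theorem negW_length (u : List A2) : (negW u).length = u.length := by simp [negW]

theorem red_append {A B : List (A2 × Bool)} (hA : FreeGroup.IsReduced A)
    (hB : FreeGroup.IsReduced B)
    (h : ∀ x ∈ A.getLast?, ∀ y ∈ B.head?, x.1 = y.1 → x.2 = y.2) :
    FreeGroup.IsReduced (A ++ B) :=
  List.isChain_append.2 ⟨hA, hB, h⟩

theorem red_pos (w : List A2) : FreeGroup.IsReduced (posW w) := by
  unfold FreeGroup.IsReduced posW
  rw [List.isChain_map]
  induction w with
  | nil => simp
  | cons a w ih => cases w <;> simp_all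

theorem red_neg (w : List A2) : FreeGroup.IsReduced (negW w) := by
  unfold FreeGroup.IsReduced negW
  rw [List.isChain_map]
  generalize w.reverse = w
  induction w with
  | nil => simp
  | cons a w ih => cases w <;> simp_all

theorem red_pos_append (w : List A2) {B : List (A2 × Bool)} (hB : FreeGroup.IsReduced B)
    (h : ∀ y ∈ B.head?, y.2 = true) : FreeGroup.IsReduced (posW w ++ B) := by
  refine red_append (red_pos w) hB ?_
  intro x hx y hy _
  rw [h y hy]
  have := List.mem_of_getLast? hx
  simp only [posW, List.mem_map] at this
  obtain ⟨a, _, rfl⟩ := this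
  rfl

theorem red_neg_append (w : List A2) {B : List (A2 × Bool)} (hB : FreeGroup.IsReduced B)
    (h : ∀ y ∈ B.head?, y.2 = false) : FreeGroup.IsReduced (negW w ++ B) := by
  refine red_append (red_neg w) hB ?_
  intro x hx y hy _
  rw [h y hy]
  have := List.mem_of_getLast? hx
  simp only [negW, List.mem_map] at this
  obtain ⟨a, _, rfl⟩ := this
  rfl

theorem red_pos_neg {u v : List A2} {z : List (A2 × Bool)} (hv : v ≠ [])
    (hl : u.getLast? ≠ v.getLast?) (h : FreeGroup.IsReduced (negW v ++ z)) :
    FreeGroup.IsReduced (posW u ++ (negW v ++ z)) := by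
  refine red_append (red_pos u) h ?_
  intro x hx y hy hxy
  exfalso
  rcases List.eq_nil_or_concat v with rfl | ⟨v', b, rfl⟩
  · exact hv rfl
  rcases List.eq_nil_or_concat u with rfl | ⟨u', a, rfl⟩
  · simp [posW] at hx
  simp [posW, negW] at hx hy hl
  subst hx hy
  exact hl hxy

theorem red_neg_pos {u v : List A2} {z : List (A2 × Bool)} (hv : v ≠ [])
    (hl : u.head? ≠ v.head?) (h : FreeGroup.IsReduced (posW v ++ z)) :
    FreeGroup.IsReduced (negW u ++ (posW v ++ z)) := by
  refine red_append (red_neg u) h ?_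
  intro x hx y hy hxy
  exfalso
  cases v with
  | nil => exact hv rfl
  | cons b v =>
  cases u with
  | nil => simp [negW] at hx
  | cons a u =>
  simp [posW, negW] at hx hy hl
  subst hx hy
  exact hl hxy

theorem nf (W : A2 → List A2) (s : List A2) (hne : ∀ i, W i ≠ [])
    (hf : ∀ i j, i ≠ j → (W i).head? ≠ (W j).head?)
    (hl : ∀ i j, i ≠ j → (W i).getLast? ≠ (W j).getLast?)
    (g : List (A2 × Bool)) (hg : FreeGroup.IsReduced g) :
    ∃ h, FreeGroup.IsReduced h ∧
      FreeGroup.lift (fun i => toFG (W i ++ s)) (FreeGroup.mk g) = FreeGroup.mk h ∧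
      g.length + (if g.head?.any (fun x => !x.2) then s.length else 0) ≤ h.length ∧
      (∀ i g', g = (i, true) :: g' → ∃ z, h = posW (W i) ++ z) ∧
      (∀ i g', g = (i, false) :: g' → ∃ z, h = negW s ++ (negW (W i) ++ z)) := by
  have hlen : ∀ i, 1 ≤ (W i).length := fun i => List.length_pos_iff.2 (hne i)
  have hposhead : ∀ i z, ∀ y ∈ (posW (W i) ++ z).head?, y.2 = true := by
    intro i z y hy
    have := hne i
    cases h : W i with
    | nil => exact absurd h this
    | cons a w => rw [h] at hy; simp [posW] at hy; rw [← hy]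
  have hneghead : ∀ i z, ∀ y ∈ (negW s ++ (negW (W i) ++ z)).head?, y.2 = false := by
    intro i z y hy
    rw [← List.append_assoc, ← negW_append] at hy
    have : W i ++ s ≠ [] := by simp [hne i]
    rcases List.eq_nil_or_concat (W i ++ s) with h | ⟨v', b, h⟩
    · exact absurd h this
    · rw [h] at hy; simp [negW] at hy; rw [← hy]
  induction g with
  | nil => exact ⟨[], by simp, by rw [← FreeGroup.one_eq_mk, map_one], by simp, by simp, by simp⟩
  | cons x g ih =>
    have hg' : FreeGroup.IsReduced g := hg.infix (List.suffix_cons x g).isInfix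
    obtain ⟨h', hr, he, hL, hp, hn⟩ := ih hg'
    obtain ⟨i, e⟩ := x
    have hmul : ∀ e, FreeGroup.mk ((i, e) :: g) = FreeGroup.mk [(i, e)] * FreeGroup.mk g := by
      intro e; rw [FreeGroup.mul_mk]; rfl
    have h1 : FreeGroup.lift (fun i => toFG (W i ++ s)) (FreeGroup.mk [(i, true)])
        = FreeGroup.mk (posW (W i ++ s)) := by
      rw [← toFG_eq]; simp
    have h2 : FreeGroup.lift (fun i => toFG (W i ++ s)) (FreeGroup.mk [(i, false)])
        = FreeGroup.mk (negW (W i ++ s)) := by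
      rw [← toFG_inv]; simp
    have hli := hlen i
    cases e with
    | true =>
      rcases g with _ | ⟨⟨j, e'⟩, g⟩
      · refine ⟨posW (W i ++ s), red_pos _, h1, by simp; omega, ?_, by simp⟩
        rintro i' g' h
        simp at h
        exact ⟨posW s, by rw [← h.1, posW_append]⟩
      · cases e' with
        | true =>
          obtain ⟨z, rfl⟩ := hp j g rfl
          refine ⟨posW (W i ++ s) ++ (posW (W j) ++ z), red_pos_append _ hr (hposhead j z), ?_,
            ?_, ?_, by simp⟩
          · rw [hmul, map_mul, he, h1, FreeGroup.mul_mk]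
          · simp at hL ⊢; omega
          · rintro i' g' h
            simp at h
            exact ⟨posW s ++ (posW (W j) ++ z), by rw [← h.1, posW_append]; simp⟩
        | false =>
          obtain ⟨z, rfl⟩ := hn j g rfl
          have hij : i ≠ j := by
            rintro rfl
            simp [FreeGroup.isReduced_cons_cons] at hg
          have hr' : FreeGroup.IsReduced (negW (W j) ++ z) :=
            hr.infix (List.suffix_append _ _).isInfix
          refine ⟨posW (W i) ++ (negW (W j) ++ z), red_pos_neg (hne j) (hl i j hij) hr', ?_,
            ?_, ?_, by simp⟩
          · rw [hmul, map_mul, he, h1, posW_append]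
            simp only [← FreeGroup.mul_mk, ← toFG_eq, ← toFG_inv]
            group
          · simp at hL ⊢; omega
          · rintro i' g' h
            simp at h
            exact ⟨(negW (W j) ++ z), by rw [← h.1]⟩
    | false =>
      rcases g with _ | ⟨⟨j, e'⟩, g⟩
      · refine ⟨negW (W i ++ s), red_neg _, h2, by simp; omega, by simp, ?_⟩
        rintro i' g' h
        simp at h
        exact ⟨[], by rw [← h.1, negW_append]; simp⟩
      · cases e' with
        | false =>
          obtain ⟨z, rfl⟩ := hn j g rfl
          refine ⟨negW (W i ++ s) ++ (negW s ++ (negW (W j) ++ z)),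
            red_neg_append _ hr (hneghead j z), ?_, ?_, by simp, ?_⟩
          · rw [hmul, map_mul, he, h2, FreeGroup.mul_mk]
          · simp at hL ⊢; omega
          · rintro i' g' h
            simp at h
            exact ⟨(negW s ++ (negW (W j) ++ z)), by rw [← h.1, negW_append]; simp⟩
        | true =>
          obtain ⟨z, rfl⟩ := hp j g rfl
          have hij : i ≠ j := by
            rintro rfl
            simp [FreeGroup.isReduced_cons_cons] at hg
          refine ⟨negW s ++ (negW (W i) ++ (posW (W j) ++ z)), ?_, ?_,
            ?_, by simp, ?_⟩
          · have := red_neg_pos (u := W i ++ s) (hne j) (z := z) (by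
              have := hf i j hij
              cases h : W i with
              | nil => exact absurd h (hne i)
              | cons a w => rw [h] at this; simpa using this) hr
            rw [negW_append] at this; simpa using this
          · rw [hmul, map_mul, he, h2, negW_append, FreeGroup.mul_mk]; simp
          · simp at hL ⊢; omega
          · rintro i' g' h
            simp at h
            exact ⟨((posW (W j) ++ z)), by rw [← h.1]⟩

theorem nielsen_letters (W : A2 → List A2) (s : List A2) (hne : ∀ i, W i ≠ [])
    (hf : ∀ i j, i ≠ j → (W i).head? ≠ (W j).head?)
    (hl : ∀ i j, i ≠ j → (W i).getLast? ≠ (W j).getLast?)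
    (hs : Function.Surjective (FreeGroup.lift (fun i => toFG (W i ++ s)))) (a : A2) :
    ∃ i, W i ++ s = [a] := by
  obtain ⟨x, hx⟩ := hs (FreeGroup.of a)
  obtain ⟨h, hr, he, hL, hp, hn⟩ := nf W s hne hf hl x.toWord FreeGroup.isReduced_toWord
  rw [FreeGroup.mk_toWord, hx] at he
  have hh : h = [(a, true)] := by
    have := congrArg FreeGroup.toWord he
    rw [FreeGroup.toWord_mk, hr.reduce_eq, FreeGroup.toWord_of] at this
    exact this.symm
  subst hh
  have hxw := FreeGroup.mk_toWord (x := x)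
  rcases hw : x.toWord with _ | ⟨⟨i, e⟩, g⟩
  · rw [hw] at hxw
    rw [← hxw, ← FreeGroup.one_eq_mk, map_one] at hx
    exact absurd hx.symm (FreeGroup.of_ne_one a)
  · rw [hw] at hL
    have : g = [] := by
      simp at hL
      exact List.length_eq_zero_iff.1 (by omega)
    subst this
    rw [hw] at hxw
    refine ⟨i, ?_⟩
    cases e with
    | true =>
      have h1 : FreeGroup.lift (fun i => toFG (W i ++ s)) (FreeGroup.mk [(i, true)])
        = FreeGroup.mk (posW (W i ++ s)) := by
        rw [← toFG_eq]; simp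
      rw [hxw, hx] at h1
      have := congrArg FreeGroup.toWord h1
      rw [FreeGroup.toWord_mk, (red_pos _).reduce_eq, FreeGroup.toWord_of] at this
      have h3 := congrArg (List.map Prod.fst) this
      simpa [posW, Function.comp_def] using h3.symm
    | false =>
      have h2 : FreeGroup.lift (fun i => toFG (W i ++ s)) (FreeGroup.mk [(i, false)])
        = FreeGroup.mk (negW (W i ++ s)) := by
        rw [← toFG_inv]; simp
      rw [hxw, hx] at h2
      have := congrArg FreeGroup.toWord h2
      rw [FreeGroup.toWord_mk, (red_neg _).reduce_eq, FreeGroup.toWord_of] at this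
      have h3 : (a, true) ∈ negW (W i ++ s) := by rw [← this]; simp
      simp [negW] at h3

end TwoSubst

namespace TwoSubst

theorem apply_append (σ : Subst) (u v : List A2) : apply σ (u ++ v) = apply σ u ++ apply σ v := by
  simp [apply]

theorem apply_cons (σ : Subst) (a : A2) (v : List A2) : apply σ (a :: v) = σ a ++ apply σ v := by
  simp [apply]

theorem apply_nil (σ : Subst) : apply σ [] = [] := rfl

theorem apply_comp (σ τ : Subst) (w : List A2) : apply (comp σ τ) w = apply σ (apply τ w) := by
  induction w with
  | nil => rfl
  | cons a w ih => simp only [apply_cons, apply_append, ih]; rfl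

theorem endo_of (ρ : Subst) (i : A2) : endo ρ (FreeGroup.of i) = toFG (ρ i) :=
  FreeGroup.lift_apply_of

theorem endo_toFG (σ : Subst) (w : List A2) : endo σ (toFG w) = toFG (apply σ w) := by
  induction w with
  | nil => simp [toFG, apply]
  | cons a w ih =>
    rw [apply_cons, toFG_append, ← ih]
    have : toFG (a :: w) = FreeGroup.of a * toFG w := by simp [toFG]
    rw [this, map_mul]
    rw [endo_of]

theorem endo_comp (σ τ : Subst) (x : FreeGroup A2) : endo (comp σ τ) x = endo σ (endo τ x) := by
  have : (endo (comp σ τ) : FreeGroup A2 →* FreeGroup A2)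
      = (endo σ : FreeGroup A2 →* FreeGroup A2).comp (endo τ) := by
    apply FreeGroup.ext_hom
    intro i
    have h1 : ∀ ρ : Subst, (endo ρ) (FreeGroup.of i) = toFG (ρ i) := fun ρ => endo_of ρ i
    change endo (comp σ τ) (FreeGroup.of i) = endo σ (endo τ (FreeGroup.of i))
    rw [h1, h1, endo_toFG]; rfl
  exact DFunLike.congr_fun this x

def phi : Subst := ![[0], [1, 0]]
def phi2 : Subst := ![[0, 1], [1]]

theorem comp_phi (u v : List A2) : comp ![u, v] phi = ![u, v ++ u] := by
  funext i; fin_cases i <;> simp [comp, phi, apply]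

theorem comp_phi2 (u v : List A2) : comp ![u, v] phi2 = ![u ++ v, v] := by
  funext i; fin_cases i <;> simp [comp, phi2, apply]

theorem bij_of_inv (f g : FreeGroup A2 →* FreeGroup A2)
    (h1 : ∀ i, f (g (FreeGroup.of i)) = FreeGroup.of i)
    (h2 : ∀ i, g (f (FreeGroup.of i)) = FreeGroup.of i) : Function.Bijective f := by
  have e1 : f.comp g = MonoidHom.id _ := FreeGroup.ext_hom _ _ h1
  have e2 : g.comp f = MonoidHom.id _ := FreeGroup.ext_hom _ _ h2
  exact Function.bijective_iff_has_inverse.2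
    ⟨g, fun x => DFunLike.congr_fun e2 x, fun x => DFunLike.congr_fun e1 x⟩

theorem phi_bij : Function.Bijective (endo phi) := by
  refine bij_of_inv (endo phi) (FreeGroup.lift ![FreeGroup.of 0, FreeGroup.of 1 * (FreeGroup.of 0)⁻¹])
    ?_ ?_ <;> intro i <;> fin_cases i <;> simp [endo, phi, toFG]

theorem phi2_bij : Function.Bijective (endo phi2) := by
  refine bij_of_inv (endo phi2) (FreeGroup.lift ![FreeGroup.of 0 * (FreeGroup.of 1)⁻¹, FreeGroup.of 1])
    ?_ ?_ <;> intro i <;> fin_cases i <;> simp [endo, phi2, toFG]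

/-- Pairs of words generated from the letters. -/
inductive Std : List A2 → List A2 → Prop
  | base01 : Std [0] [1]
  | base10 : Std [1] [0]
  | r1 {u v} : Std u v → Std u (v ++ u)
  | r2 {u v} : Std u v → Std (u ++ v) v

theorem Std.symm {u v : List A2} (h : Std u v) : Std v u := by
  induction h with
  | base01 => exact .base10
  | base10 => exact .base01
  | r1 _ ih => exact .r2 ih
  | r2 _ ih => exact .r1 ih

theorem Std.bij {u v : List A2} (h : Std u v) : Function.Bijective (endo ![u, v]) := by
  induction h with
  | base01 =>
    refine bij_of_inv (endo _) (MonoidHom.id _) ?_ ?_ <;> intro i <;> fin_cases i <;>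
      simp [endo, toFG]
  | base10 =>
    refine bij_of_inv (endo _) (endo ![[1], [0]]) ?_ ?_ <;> intro i <;> fin_cases i <;>
      simp [endo, toFG]
  | @r1 u v _ ih =>
    rw [← comp_phi]
    have : (endo (comp ![u, v] phi) : FreeGroup A2 → FreeGroup A2) = endo ![u, v] ∘ endo phi :=
      funext fun x => endo_comp _ _ x
    rw [this]; exact ih.comp phi_bij
  | @r2 u v _ ih =>
    rw [← comp_phi2]
    have : (endo (comp ![u, v] phi2) : FreeGroup A2 → FreeGroup A2) = endo ![u, v] ∘ endo phi2 :=
      funext fun x => endo_comp _ _ x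
    rw [this]; exact ih.comp phi2_bij

theorem Std.det {u v : List A2} (h : Std u v) :
    ((u.count 0 : ℤ) * v.count 1 - (v.count 0 : ℤ) * u.count 1) ^ 2 = 1 := by
  induction h with
  | base01 => simp
  | base10 => simp
  | r1 _ ih => rw [← ih]; simp only [List.count_append]; push_cast; ring
  | r2 _ ih => rw [← ih]; simp only [List.count_append]; push_cast; ring

theorem std_of_central (n : ℕ) : ∀ (u v : List A2), u.length + v.length ≤ n → u ≠ [] → v ≠ [] →
    ∀ (x y : A2) (s : List A2), x ≠ y →
    u ++ v = x :: y :: s → v ++ u = y :: x :: s → Std u v := by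
  -- the case of a shorter first word
  have key : ∀ (u v : List A2), u ≠ [] → v ≠ [] → u.length ≤ v.length → 
    ∀ (x y : A2) (s : List A2), x ≠ y →
    u ++ v = x :: y :: s → v ++ u = y :: x :: s → (u = [x] ∧ v = [y]) ∨
      ∃ v' s', v' ≠ [] ∧ v = v' ++ u ∧ u ++ v' = x :: y :: s' ∧ v' ++ u = y :: x :: s' := by
    intro u v hu hv hle x y s hxy h1 h2
    obtain ⟨a, u1, rfl⟩ := List.exists_cons_of_ne_nil hu
    obtain ⟨b, v1, rfl⟩ := List.exists_cons_of_ne_nil hv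
    have hl := congrArg List.length h1
    simp at hl
    obtain rfl : a = x := by simp at h1; exact h1.1
    obtain rfl : b = y := by simp at h2; exact h2.1
    rcases Nat.eq_zero_or_pos v1.length with h0 | h0
    · left
      have : v1 = [] := List.length_eq_zero_iff.1 h0
      subst this
      have : u1 = [] := List.length_eq_zero_iff.1 (by simp at hle; simpa using hle)
      subst this
      simp
    · right
      have s1 : (a :: u1) <:+ s := by
        have : (a :: u1) <:+ [b, a] ++ s := by
          have := List.suffix_append (b :: v1) (a :: u1)
          rw [h2] at this; simpa using this
        exact List.suffix_of_suffix_length_le this (List.suffix_append _ _) (by simp; omega)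
      have s2 : (a :: u1) <:+ (b :: v1) := by
        have h3 : (a :: u1) <:+ (a :: u1) ++ (b :: v1) := by
          rw [h1]; exact s1.trans ((List.suffix_cons _ _).trans (List.suffix_cons _ _))
        exact List.suffix_of_suffix_length_le h3 (List.suffix_append _ _) hle
      obtain ⟨v', hv'⟩ := s2
      obtain ⟨s', hs'⟩ := s1
      refine ⟨v', s', ?_, hv'.symm, ?_, ?_⟩
      · rintro rfl
        simp at hv'
        exact hxy hv'.1
      · rw [← hv', ← hs', ← List.append_assoc] at h1
        exact List.append_cancel_right (by simpa using h1 : _ ++ (a :: u1) = (a :: b :: s') ++ (a :: u1))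
      · rw [← hv', ← hs'] at h2
        exact List.append_cancel_right (by simpa using h2 : _ ++ (a :: u1) = (b :: a :: s') ++ (a :: u1))
  have base : ∀ x y : A2, x ≠ y → Std [x] [y] := by
    intro x y hxy
    fin_cases x <;> fin_cases y <;> simp at hxy
    · exact .base01
    · exact .base10
  induction n with
  | zero =>
    intro u v hn hu
    have := List.length_pos_iff.2 hu
    omega
  | succ n ih =>
    intro u v hn hu hv x y s hxy h1 h2
    have lu := List.length_pos_iff.2 hu
    have lv := List.length_pos_iff.2 hv
    rcases le_total u.length v.length with hle | hle
    · rcases key u v hu hv hle x y s hxy h1 h2 with ⟨rfl, rfl⟩ | ⟨v', s', hv', rfl, h3, h4⟩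
      · exact base x y hxy
      · refine .r1 (ih u v' ?_ hu hv' x y s' hxy h3 h4)
        simp at hn; omega
    · rcases key v u hv hu hle y x s hxy.symm h2 h1 with ⟨rfl, rfl⟩ | ⟨v', s', hv', rfl, h3, h4⟩
      · exact base x y hxy
      · refine .r2 (ih v' v ?_ hv' hv x y s' hxy h4 h3)
        simp at hn; omega

theorem exists_lcs (u v : List A2) : ∃ u' v' s, u = u' ++ s ∧ v = v' ++ s ∧
    (u' = [] ∨ v' = [] ∨ u'.getLast? ≠ v'.getLast?) := by
  induction u using List.reverseRecOn generalizing v with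
  | nil => exact ⟨[], v, [], by simp⟩
  | append_singleton u a ih =>
    rcases List.eq_nil_or_concat v with rfl | ⟨v, b, rfl⟩
    · exact ⟨u ++ [a], [], [], by simp⟩
    · by_cases hab : a = b
      · subst hab
        obtain ⟨u', v', s, h1, h2, h3⟩ := ih v
        exact ⟨u', v', s ++ [a], by simp [h1], by simp [h2], h3⟩
      · exact ⟨u ++ [a], v ++ [b], [], by simp, by simp, by simp [hab]⟩

theorem std_of_surj (n : ℕ) : ∀ (u v : List A2), u.length + v.length ≤ n → u ≠ [] → v ≠ [] →
    u.head? ≠ v.head? → Function.Surjective (endo ![u, v]) → Std u v := by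
  induction n with
  | zero =>
    intro u v hn hu
    have := List.length_pos_iff.2 hu
    omega
  | succ n ih =>
    intro u v hn hu hv hh hs
    have lu := List.length_pos_iff.2 hu
    have lv := List.length_pos_iff.2 hv
    obtain ⟨u', v', s, h1, h2, h3⟩ := exists_lcs u v
    by_cases hu' : u' = []
    · subst hu'
      simp at h1
      subst h1
      have hv' : v' ≠ [] := by
        rintro rfl
        simp at h2; exact hh (by rw [h2])
      subst h2
      refine .r1 (ih u v' ?_ hu hv' ?_ ?_)
      · simp at hn; omega
      · obtain ⟨b, v1, rfl⟩ := List.exists_cons_of_ne_nil hv'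
        simpa using hh
      · rw [← comp_phi] at hs
        intro x
        obtain ⟨y, rfl⟩ := hs x
        exact ⟨_, (endo_comp _ _ y).symm⟩
    by_cases hv' : v' = []
    · subst hv'
      simp at h2
      subst h2
      subst h1
      refine .r2 (ih u' v ?_ hu' hv ?_ ?_)
      · simp at hn; omega
      · obtain ⟨b, v1, rfl⟩ := List.exists_cons_of_ne_nil hu'
        simpa using hh
      · rw [← comp_phi2] at hs
        intro x
        obtain ⟨y, rfl⟩ := hs x
        exact ⟨_, (endo_comp _ _ y).symm⟩
    simp only [hu', hv', false_or] at h3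
    have hh' : u'.head? ≠ v'.head? := by
      obtain ⟨a, u1, rfl⟩ := List.exists_cons_of_ne_nil hu'
      obtain ⟨b, v1, rfl⟩ := List.exists_cons_of_ne_nil hv'
      rw [h1, h2] at hh
      simpa using hh
    have hfun : (fun i => toFG ((![u', v'] : A2 → List A2) i ++ s)) = fun i => toFG ((![u, v] : A2 → List A2) i) := by
      funext i; fin_cases i <;> simp [h1, h2]
    have key := nielsen_letters ![u', v'] s
      (by intro i; fin_cases i <;> simp [hu', hv'])
      (by intro i j hij; fin_cases i <;> fin_cases j <;> simp at hij ⊢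
          · exact hh'
          · exact hh'.symm)
      (by intro i j hij; fin_cases i <;> fin_cases j <;> simp at hij ⊢
          · exact h3
          · exact h3.symm)
      (by rw [hfun]; exact hs)
    obtain ⟨i, hi⟩ := key 0
    obtain ⟨j, hj⟩ := key 1
    fin_cases i <;> fin_cases j <;> simp [← h1, ← h2] at hi hj
    · rw [hi] at hj; simp at hj
    · rw [hi, hj]; exact .base01
    · rw [hi, hj]; exact .base10
    · rw [hi] at hj; simp at hj

theorem rotation (t : List A2) : ∀ (u v : List A2) (x y : A2) (r r' : List A2), u ≠ [] → v ≠ [] →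
    u ++ v = t ++ x :: r → v ++ u = t ++ y :: r' →
    ∃ u' v', u' ≠ [] ∧ v' ≠ [] ∧ u ++ t = t ++ u' ∧ v ++ t = t ++ v' := by
  induction t with
  | nil =>
    intro u v x y r r' hu hv h1 h2
    exact ⟨u, v, hu, hv, by simp, by simp⟩
  | cons c t ih =>
    intro u v x y r r' hu hv h1 h2
    obtain ⟨a, u1, rfl⟩ := List.exists_cons_of_ne_nil hu
    obtain ⟨b, v1, rfl⟩ := List.exists_cons_of_ne_nil hv
    simp at h1 h2
    obtain ⟨rfl, h1⟩ := h1
    obtain ⟨rfl, h2⟩ := h2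
    obtain ⟨u', v', hu', hv', h3, h4⟩ := ih (u1 ++ [b]) (v1 ++ [b]) x y (r ++ [b]) (r' ++ [b])
      (by simp) (by simp)
      (by have := congrArg (· ++ [b]) h1; simpa using this)
      (by have := congrArg (· ++ [b]) h2; simpa using this)
    exact ⟨u', v', hu', hv', by simpa using h3, by simpa using h4⟩

theorem exists_lcp (u v : List A2) (hl : u.length = v.length) (h : u ≠ v) :
    ∃ t x y r r', x ≠ y ∧ u = t ++ x :: r ∧ v = t ++ y :: r' := by
  induction u generalizing v with
  | nil => exact absurd (List.length_eq_zero_iff.1 hl.symm).symm h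
  | cons a u ih =>
    cases v with
    | nil => simp at hl
    | cons b v =>
      by_cases hab : a = b
      · subst hab
        obtain ⟨t, x, y, r, r', h1, h2, h3⟩ := ih v (by simpa using hl) (by simpa using h)
        exact ⟨a :: t, x, y, r, r', h1, by simp [h2], by simp [h3]⟩
      · exact ⟨[], a, b, u, v, hab, rfl, rfl⟩

theorem subst_eta (σ : Subst) : ![σ 0, σ 1] = σ := by
  funext i; fin_cases i <;> rfl

theorem conj_endo (σ τ : Subst) (t : List A2) (h : ∀ i, σ i ++ t = t ++ τ i) (x : FreeGroup A2) :
    endo σ x = toFG t * endo τ x * (toFG t)⁻¹ := by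
  have : (endo σ : FreeGroup A2 →* FreeGroup A2)
      = (MulAut.conj (toFG t)).toMonoidHom.comp (endo τ : FreeGroup A2 →* FreeGroup A2) := by
    apply FreeGroup.ext_hom
    intro i
    have h1 : ∀ ρ : Subst, (endo ρ) (FreeGroup.of i) = toFG (ρ i) := fun ρ => endo_of ρ i
    change endo σ (FreeGroup.of i) = toFG t * endo τ (FreeGroup.of i) * (toFG t)⁻¹
    rw [h1, h1, ← toFG_append, ← h, toFG_append]; group
  exact DFunLike.congr_fun this x

theorem conj_bij (σ τ : Subst) (t : List A2) (h : ∀ i, σ i ++ t = t ++ τ i) :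
    Function.Bijective (endo σ) ↔ Function.Bijective (endo τ) := by
  have : (endo σ : FreeGroup A2 → FreeGroup A2) = MulAut.conj (toFG t) ∘ endo τ :=
    funext fun x => conj_endo σ τ t h x
  rw [this]
  exact Function.Bijective.of_comp_iff' (MulAut.conj (toFG t)).bijective _

theorem std_of_invertible (σ : Subst) (hne : NonErasing σ) (h : IsInvertible σ) :
    ∃ (t : List A2) (τ : Subst), (∀ i, σ i ++ t = t ++ τ i) ∧ Std (τ 0) (τ 1) := by
  have hcomm : σ 0 ++ σ 1 ≠ σ 1 ++ σ 0 := by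
    intro hc
    have h1 : endo σ (toFG [0, 1]) = endo σ (toFG [1, 0]) := by
      rw [endo_toFG, endo_toFG]; simp [apply, hc]
    have h2 := h.1 h1
    rw [toFG_eq, toFG_eq] at h2
    have := congrArg FreeGroup.toWord h2
    rw [FreeGroup.toWord_mk, FreeGroup.toWord_mk, (red_pos _).reduce_eq, (red_pos _).reduce_eq] at this
    simp [posW] at this
  obtain ⟨t, x, y, r, r', hxy, h1, h2⟩ := exists_lcp _ _ (by simp [add_comm]) hcomm
  obtain ⟨u', v', hu', hv', h3, h4⟩ := rotation t _ _ x y r r' (hne 0) (hne 1) h1 h2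
  refine ⟨t, ![u', v'], ?_, ?_⟩
  · intro i; fin_cases i
    · exact h3
    · exact h4
  · have hb := (conj_bij σ ![u', v'] t (by
      intro i; fin_cases i
      · exact h3
      · exact h4)).1 h
    refine std_of_surj _ u' v' le_rfl hu' hv' ?_ hb.2
    have e1 : u' ++ v' = x :: (r ++ t) := by
      have : t ++ (u' ++ v') = t ++ (x :: (r ++ t)) := by
        rw [← List.append_assoc, ← h3, List.append_assoc, ← h4, ← List.append_assoc, h1]; simp
      exact List.append_cancel_left this
    have e2 : v' ++ u' = y :: (r' ++ t) := by
      have : t ++ (v' ++ u') = t ++ (y :: (r' ++ t)) := by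
        rw [← List.append_assoc, ← h4, List.append_assoc, ← h3, ← List.append_assoc, h2]; simp
      exact List.append_cancel_left this
    obtain ⟨b, v1, rfl⟩ := List.exists_cons_of_ne_nil hu'
    obtain ⟨c, v2, rfl⟩ := List.exists_cons_of_ne_nil hv'
    simp at e1 e2 ⊢
    rw [e1.1, e2.1]; exact hxy

theorem invertible_of_swap (σ : Subst) (hne : NonErasing σ) (t s : List A2) (x y : A2) (hxy : x ≠ y)
    (h1 : σ 0 ++ σ 1 = t ++ x :: y :: s) (h2 : σ 1 ++ σ 0 = t ++ y :: x :: s) :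
    IsInvertible σ := by
  obtain ⟨u', v', hu', hv', h3, h4⟩ := rotation t _ _ x y _ _ (hne 0) (hne 1) h1 h2
  have e1 : u' ++ v' = x :: y :: (s ++ t) := by
    have : t ++ (u' ++ v') = t ++ (x :: y :: (s ++ t)) := by
      rw [← List.append_assoc, ← h3, List.append_assoc, ← h4, ← List.append_assoc, h1]; simp
    exact List.append_cancel_left this
  have e2 : v' ++ u' = y :: x :: (s ++ t) := by
    have : t ++ (v' ++ u') = t ++ (y :: x :: (s ++ t)) := by
      rw [← List.append_assoc, ← h4, List.append_assoc, ← h3, ← List.append_assoc, h2]; simp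
    exact List.append_cancel_left this
  have := std_of_central _ u' v' le_rfl hu' hv' x y _ hxy e1 e2
  exact (conj_bij σ ![u', v'] t (by
      intro i; fin_cases i
      · exact h3
      · exact h4)).2 this.bij

/-! ### The balance property -/

def Bal (w : List A2) : Prop :=
  ∀ p : List A2, ¬ ((0 :: (p ++ [0])) <:+: w ∧ (1 :: (p ++ [1])) <:+: w)

theorem Bal.infix {v w : List A2} (h : Bal w) (hv : v <:+: w) : Bal v :=
  fun p hp => h p ⟨hp.1.trans hv, hp.2.trans hv⟩

def sw : A2 → A2 := fun i => 1 - i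

theorem sw_sw (i : A2) : sw (sw i) = i := by fin_cases i <;> rfl

theorem apply_E (w : List A2) : apply ![[1], [0]] w = w.map sw := by
  induction w with
  | nil => rfl
  | cons a w ih => rw [apply_cons, ih]; fin_cases a <;> rfl

theorem bal_sw {w : List A2} (h : Bal w) : Bal (w.map sw) := by
  intro p ⟨h1, h2⟩
  have hw : (w.map sw).map sw = w := by simp [Function.comp_def, sw_sw]
  have h1' := List.IsInfix.map sw h1
  have h2' := List.IsInfix.map sw h2
  rw [hw] at h1' h2'
  refine h (p.map sw) ⟨?_, ?_⟩
  · simpa [sw] using h2'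
  · simpa [sw] using h1'

theorem phi_split (w : List A2) : ∀ x y : List A2, apply phi w = x ++ y → x.getLast? ≠ some 1 →
    ∃ w1 w2, w = w1 ++ w2 ∧ apply phi w1 = x ∧ apply phi w2 = y := by
  induction w with
  | nil =>
    intro x y h _
    rw [apply_nil] at h
    simp at h
    exact ⟨[], [], rfl, h.1.symm ▸ rfl, h.2.symm ▸ rfl⟩
  | cons a w ih =>
    intro x y h hx
    cases x with
    | nil => exact ⟨[], a :: w, rfl, rfl, by simpa using h⟩
    | cons c x =>
      rw [apply_cons] at h
      have ha : a = 0 ∨ a = 1 := by fin_cases a <;> simp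
      rcases ha with rfl | rfl
      · simp [phi] at h
        obtain ⟨rfl, h⟩ := h
        obtain ⟨w1, w2, rfl, h1, h2⟩ := ih x y h (by
          intro h3; apply hx; cases x <;> simp_all [List.getLast?_cons])
        exact ⟨0 :: w1, w2, rfl, by rw [apply_cons, h1]; simp [phi], h2⟩
      · simp [phi] at h
        obtain ⟨rfl, h⟩ := h
        cases x with
        | nil => simp at hx
        | cons d x =>
          simp at h
          obtain ⟨rfl, h⟩ := h
          obtain ⟨w1, w2, rfl, h1, h2⟩ := ih x y h (by
            intro h3; apply hx; cases x <;> simp_all [List.getLast?_cons])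
          exact ⟨1 :: w1, w2, rfl, by rw [apply_cons, h1]; simp [phi], h2⟩

theorem phi_inj (v w : List A2) (h : apply phi v = apply phi w) : v = w := by
  induction v generalizing w with
  | nil =>
    cases w with
    | nil => rfl
    | cons a w => fin_cases a <;> simp [apply, phi] at h
  | cons b v ih =>
    cases w with
    | nil => fin_cases b <;> simp [apply, phi] at h
    | cons a w =>
      rw [apply_cons, apply_cons] at h
      fin_cases a <;> fin_cases b <;> simp [phi] at h
      · rw [ih w h]
      · rw [ih w h]

theorem phi_last (w : List A2) : (apply phi w).getLast? ≠ some 1 := by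
  induction w using List.reverseRecOn with
  | nil => simp [apply]
  | append_singleton w a _ =>
    rw [apply_append]
    fin_cases a <;> simp [apply, phi]

theorem phi_no11 (w x y : List A2) : apply phi w ≠ x ++ 1 :: 1 :: y := by
  intro h
  by_cases hx : x.getLast? = some 1
  · induction w generalizing x with
    | nil => simp [apply] at h
    | cons a w ih =>
      rw [apply_cons] at h
      cases x with
      | nil => simp at hx
      | cons c x =>
      have ha : a = 0 ∨ a = 1 := by fin_cases a <;> simp
      rcases ha with rfl | rfl
      · simp [phi] at h
        exact ih x h.2 (by rw [← h.1] at hx; cases x <;> simp_all [List.getLast?_cons])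
      · simp [phi] at h
        cases x with
        | nil => simp at h
        | cons d x =>
          simp at h
          refine ih x h.2.2 ?_
          cases x with
          | nil =>
            simp [← h.2.1] at hx
          | cons e x => simpa [List.getLast?_cons] using hx
  · obtain ⟨w1, w2, _, _, h2⟩ := phi_split w x _ h hx
    cases w2 with
    | nil => simp [apply] at h2
    | cons a w2 => fin_cases a <;> simp [apply, phi] at h2

theorem bal_phi {w : List A2} (hw : Bal w) : Bal (apply phi w) := by
  rintro p ⟨⟨x1, y1, h1⟩, ⟨x2, y2, h2⟩⟩
  have ha : ∀ a : A2, a = 0 ∨ a = 1 := by intro a; fin_cases a <;> simp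
  -- `p` is nonempty, starts and ends with `0`
  cases p with
  | nil => exact phi_no11 w x2 y2 (by rw [← h2]; simp)
  | cons c p' =>
  rcases ha c with rfl | rfl
  swap
  · exact phi_no11 w x2 (p' ++ [1] ++ y2) (by rw [← h2]; simp)
  have hlast : (0 :: p').getLast? ≠ some 1 := by
    intro hl
    obtain ⟨q, hq⟩ := List.getLast?_eq_some_iff.1 hl
    rw [hq] at h2
    exact phi_no11 w (x2 ++ 1 :: q) y2 (by rw [← h2]; simp)
  -- the occurrence of `1 p 1`
  have hx2 : x2.getLast? ≠ some 1 := by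
    intro hl
    obtain ⟨q, hq⟩ := List.getLast?_eq_some_iff.1 hl
    rw [hq] at h2
    exact phi_no11 w q (0 :: p' ++ [1] ++ y2) (by rw [← h2]; simp)
  obtain ⟨w1, w2, rfl, e1, e2⟩ := phi_split w x2 (1 :: 0 :: p' ++ 1 :: y2) (by rw [← h2]; simp) hx2
  obtain ⟨w3, w4, rfl, e3, e4⟩ := phi_split w2 (1 :: 0 :: p') (1 :: y2) e2 (by
    simpa [List.getLast?_cons] using hlast)
  cases w3 with
  | nil => simp [apply] at e3
  | cons d q =>
  rcases ha d with rfl | rfl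
  · simp [apply, phi] at e3
  have e5 : apply phi q = p' := by simpa [apply, phi] using e3
  cases w4 with
  | nil => simp [apply] at e4
  | cons d w4 =>
  rcases ha d with rfl | rfl
  · simp [apply, phi] at e4
  -- the occurrence of `0 p 0`
  have h1' : apply phi (w1 ++ (1 :: q ++ 1 :: w4)) = (x1 ++ [0]) ++ (0 :: p' ++ 0 :: y1) := by
    rw [← h1]; simp
  obtain ⟨v1, v2, g0, g1, g2⟩ := phi_split _ _ _ h1' (by simp)
  obtain ⟨v3, v4, rfl, g3, g4⟩ := phi_split v2 (0 :: p') (0 :: y1) g2 hlast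
  have : v3 = 0 :: q := phi_inj _ _ (by rw [g3, apply_cons, e5]; simp [phi])
  subst this
  cases v4 with
  | nil => simp [apply] at g4
  | cons d v4 =>
  rcases ha d with rfl | rfl
  swap
  · simp [apply, phi] at g4
  refine hw q ⟨?_, ?_⟩
  · exact ⟨v1, v4, by rw [g0]; simp⟩
  · exact ⟨w1, w4, by simp⟩

theorem bal_phi2 {w : List A2} (hw : Bal w) : Bal (apply phi2 w) := by
  have h := bal_sw (bal_phi (bal_sw hw))
  have : ((apply phi (w.map sw)).map sw) = apply phi2 w := by
    clear h hw
    induction w with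
    | nil => rfl
    | cons a w ih =>
      rw [apply_cons, List.map_cons, apply_cons, List.map_append, ih]
      fin_cases a <;> rfl
  rwa [this] at h

theorem Std.bal {u v : List A2} (h : Std u v) : ∀ w, Bal w → Bal (apply ![u, v] w) := by
  induction h with
  | base01 =>
    intro w hw
    have : apply ![[0], [1]] w = w := by
      clear hw
      induction w with
      | nil => rfl
      | cons a w ih => rw [apply_cons, ih]; fin_cases a <;> rfl
    rwa [this]
  | base10 => intro w hw; rw [apply_E]; exact bal_sw hw
  | r1 _ ih => intro w hw; rw [← comp_phi, apply_comp]; exact ih _ (bal_phi hw)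
  | r2 _ ih => intro w hw; rw [← comp_phi2, apply_comp]; exact ih _ (bal_phi2 hw)

end TwoSubst

namespace TwoSubst

theorem iter_flat (σ : Subst) (n : ℕ) (w : List A2) : (apply σ)^[n] w = apply (substPow σ n) w := by
  have happ : ∀ n (u v : List A2), (apply σ)^[n] (u ++ v) = (apply σ)^[n] u ++ (apply σ)^[n] v := by
    intro n
    induction n with
    | zero => intro u v; rfl
    | succ n ih => intro u v; simp only [Function.iterate_succ_apply, apply_append, ih]
  induction w with
  | nil =>
    have : ∀ n, (apply σ)^[n] [] = [] := by
      intro n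
      induction n with
      | zero => rfl
      | succ n ih => rw [Function.iterate_succ_apply, apply_nil, ih]
    rw [this, apply_nil]
  | cons a w ih =>
    rw [apply_cons, ← ih]
    exact happ n [a] w

theorem substPow_add (σ : Subst) (m n : ℕ) (x : A2) :
    substPow σ (m + n) x = apply (substPow σ m) (substPow σ n x) := by
  rw [← iter_flat]
  simp only [substPow, Function.iterate_add_apply]

theorem substPow_one (σ : Subst) (x : A2) : substPow σ 1 x = σ x := by
  simp [substPow, apply]

theorem substPow_zero (σ : Subst) (x : A2) : substPow σ 0 x = [x] := by
  simp [substPow]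

theorem count_apply (σ : Subst) (i : A2) (w : List A2) :
    ((apply σ w).count i : ℤ) = M σ i 0 * w.count 0 + M σ i 1 * w.count 1 := by
  induction w with
  | nil => simp [apply]
  | cons a w ih =>
    rw [apply_cons, List.count_append]
    push_cast
    rw [ih]
    fin_cases a <;> simp [M] <;> ring

theorem M_pow (σ : Subst) (n : ℕ) (i j : A2) : (M σ ^ n) i j = ((substPow σ n j).count i : ℤ) := by
  induction n generalizing i j with
  | zero => 
    rw [substPow_zero]; fin_cases i <;> fin_cases j <;> simp
  | succ n ih =>
    rw [Nat.add_comm, substPow_add, count_apply, pow_add, pow_one, Matrix.mul_apply]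
    simp only [Fin.sum_univ_two, ih]
    have : substPow σ 1 = σ := by funext x; exact substPow_one σ x
    rw [this]

theorem apply_ne_nil (σ : Subst) (hne : NonErasing σ) (w : List A2) (hw : w ≠ []) : apply σ w ≠ [] := by
  cases w with
  | nil => exact absurd rfl hw
  | cons a w => rw [apply_cons]; intro h; exact hne a (List.append_eq_nil_iff.1 h).1

theorem substPow_ne (σ : Subst) (hne : NonErasing σ) (n : ℕ) (x : A2) : substPow σ n x ≠ [] := by
  induction n with
  | zero => simp [substPow_zero]
  | succ n ih =>
    rw [Nat.add_comm, substPow_add]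
    have : substPow σ 1 = σ := by funext x; exact substPow_one σ x
    rw [this]; exact apply_ne_nil σ hne _ ih

theorem prim_mem (σ : Subst) (hne : NonErasing σ) (hp : Primitive σ) :
    ∃ K, 0 < K ∧ ∀ N, K ≤ N → ∀ i j, i ∈ substPow σ N j := by
  obtain ⟨K, hK, h⟩ := hp
  refine ⟨K, hK, fun N hN i j => ?_⟩
  obtain ⟨m, rfl⟩ := Nat.exists_eq_add_of_le hN
  rw [substPow_add]
  obtain ⟨a, l, hl⟩ := List.exists_cons_of_ne_nil (substPow_ne σ hne m j)
  rw [hl, apply_cons]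
  refine List.mem_append_left _ ?_
  have := h i a
  rw [M_pow] at this
  exact List.count_pos_iff.1 (by exact_mod_cast this)

theorem apply_len_ge (σ : Subst) (c : ℕ) (h : ∀ x, c ≤ (σ x).length) (w : List A2) :
    c * w.length ≤ (apply σ w).length := by
  induction w with
  | nil => simp
  | cons a w ih => rw [apply_cons, List.length_append, List.length_cons]; have := h a; nlinarith

theorem growth (σ : Subst) (hne : NonErasing σ) (hp : Primitive σ) (B : ℕ) :
    ∃ N, ∀ x, B ≤ (substPow σ N x).length := by
  obtain ⟨K, hK, h⟩ := prim_mem σ hne hp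
  have h2 : ∀ x, 2 ≤ (substPow σ K x).length := by
    intro x
    have h0 := h K le_rfl 0 x
    have h1 := h K le_rfl 1 x
    rcases hl : substPow σ K x with _ | ⟨a, _ | ⟨b, l⟩⟩
    · rw [hl] at h0; simp at h0
    · rw [hl] at h0 h1; simp at h0 h1; rw [← h0] at h1; simp at h1
    · simp
  induction B with
  | zero => exact ⟨0, fun x => Nat.zero_le _⟩
  | succ B ih =>
    obtain ⟨N, hN⟩ := ih
    refine ⟨K + N, fun x => ?_⟩
    rw [substPow_add]
    have := apply_len_ge (substPow σ K) 2 h2 (substPow σ N x)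
    have h3 := List.length_pos_iff.2 (substPow_ne σ hne N x)
    have := hN x
    omega

def Lang (σ : Subst) (w : List A2) : Prop := ∃ (n : ℕ) (x : A2), w <:+: substPow σ n x

theorem Lang.infix {σ : Subst} {v w : List A2} (h : Lang σ w) (hv : v <:+: w) : Lang σ v := by
  obtain ⟨n, x, h⟩ := h; exact ⟨n, x, hv.trans h⟩

theorem apply_infix (σ : Subst) {v w : List A2} (h : v <:+: w) : apply σ v <:+: apply σ w := by
  obtain ⟨s, t, rfl⟩ := h
  rw [apply_append, apply_append]; exact ⟨_, _, rfl⟩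

theorem Lang.apply {σ : Subst} {w : List A2} (h : Lang σ w) : Lang σ (apply σ w) := by
  obtain ⟨n, x, h⟩ := h
  refine ⟨1 + n, x, ?_⟩
  have : substPow σ 1 = σ := by funext x; exact substPow_one σ x
  rw [substPow_add, this]; exact apply_infix σ h

theorem mem_infix_apply (σ : Subst) {x : A2} {w : List A2} (h : x ∈ w) : σ x <:+: TwoSubst.apply σ w := by
  obtain ⟨s, t, rfl⟩ := List.append_of_mem h
  rw [apply_append, apply_cons]
  exact ⟨TwoSubst.apply σ s, TwoSubst.apply σ t, by simp⟩

theorem Lang.all {σ : Subst} (hne : NonErasing σ) (hp : Primitive σ) {w : List A2} (h : Lang σ w) :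
    ∃ N0, ∀ N, N0 ≤ N → ∀ y, w <:+: substPow σ N y := by
  obtain ⟨K, hK, hm⟩ := prim_mem σ hne hp
  obtain ⟨n, x, h⟩ := h
  refine ⟨n + K, fun N hN y => ?_⟩
  obtain ⟨m, rfl⟩ := Nat.exists_eq_add_of_le hN
  rw [Nat.add_assoc, substPow_add]
  exact h.trans (mem_infix_apply _ (hm _ (by omega) _ _))

theorem block (f : Subst) (B : ℕ) (hB : ∀ y, (f y).length ≤ B) (z : List A2) : ∀ v, v <:+: apply f z →
    2 * B < v.length → ∃ y, f y <:+: v := by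
  induction z with
  | nil => intro v hv hl; have := hv.length_le; rw [apply_nil, List.length_nil] at this; omega
  | cons a z ih =>
    rintro v ⟨s, t, h⟩ hl
    rw [apply_cons, List.append_assoc, List.append_eq_append_iff] at h
    rcases h with ⟨p, h1, h2⟩ | ⟨p, h1, h2⟩
    · rw [List.append_eq_append_iff] at h2
      have hp : p.length ≤ B := by have := hB a; rw [h1, List.length_append] at this; omega
      rcases h2 with ⟨q, h3, h4⟩ | ⟨q, h3, h4⟩
      · exfalso; rw [h3, List.length_append] at hp; omega
      · rw [h3, List.length_append] at hl
        cases z with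
        | nil =>
          rw [apply_nil] at h4
          have := (List.append_eq_nil_iff.1 h4.symm).1
          subst this; simp at hl; omega
        | cons b z =>
          rw [apply_cons] at h4
          refine ⟨b, ?_⟩
          rw [List.append_eq_append_iff] at h4
          rcases h4 with ⟨r, h5, h6⟩ | ⟨r, h5, h6⟩
          · rw [h3, h5]; exact ⟨p, r, by simp⟩
          · have := hB b
            rw [h5, List.length_append] at this
            omega
    · refine ih v ⟨p, t, ?_⟩ hl
      rw [h2, List.append_assoc]

def C (u : ℤ → A2) (n : ℕ) (k : ℤ) : List A2 := (List.range n).map fun i : ℕ => u (k + (i : ℤ))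

theorem C_len (u : ℤ → A2) (n : ℕ) (k : ℤ) : (C u n k).length = n := by simp [C]

theorem C_add (u : ℤ → A2) (m n : ℕ) (k : ℤ) : C u (m + n) k = C u m k ++ C u n (k + m) := by
  simp only [C, List.range_add, List.map_append, List.map_map]
  congr 1
  apply List.map_congr_left
  intro i _
  simp [add_assoc]

theorem C_eq (u : ℤ → A2) (n : ℕ) (k j : ℤ) : C u n k = C u n j ↔ ∀ t : ℕ, t < n → u (k + t) = u (j + t) := by
  simp [C]

theorem C_infix (u : ℤ → A2) {n : ℕ} {k : ℤ} {w : List A2} (h : w <:+: C u n k) :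
    ∃ j : ℤ, k ≤ j ∧ j + w.length ≤ k + n ∧ w = C u w.length j := by
  obtain ⟨s, t, h⟩ := h
  have hl : n = s.length + (w.length + t.length) := by
    have := congrArg List.length h; rw [C_len] at this; simp at this; omega
  refine ⟨k + s.length, by omega, by omega, ?_⟩
  rw [hl, C_add, C_add, List.append_assoc] at h
  have h1 := List.append_inj h (by simp [C_len])
  exact (List.append_inj h1.2 (by simp [C_len])).1

theorem isFactor_iff (w : List A2) (u : ℤ → A2) : IsFactor w u ↔ ∃ k : ℤ, w = C u w.length k := by
  unfold IsFactor C
  have : ∀ l : List ℕ, (do let a ← l; pure (a : ℤ)) = l.map (fun i : ℕ => (i : ℤ)) := by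
    intro l
    rw [List.map_eq_flatMap]; rfl
  simp only [this, List.map_map]
  rfl

theorem hull_iff (σ : Subst) (u : ℤ → A2) : u ∈ Hull σ ↔ ∀ n k, Lang σ (C u n k) := by
  constructor
  · intro h n k
    exact h _ ((isFactor_iff _ _).2 ⟨k, by rw [C_len]⟩)
  · intro h w hw
    obtain ⟨k, hk⟩ := (isFactor_iff _ _).1 hw
    rw [hk]; exact h _ _

theorem recur {σ : Subst} (hne : NonErasing σ) (hp : Primitive σ) {u : ℤ → A2} (hu : u ∈ Hull σ)
    {w : List A2} (hw : Lang σ w) :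
    ∃ R : ℕ, ∀ k : ℤ, ∃ j : ℤ, k ≤ j ∧ j + w.length ≤ k + R ∧ w = C u w.length j := by
  obtain ⟨N, hN⟩ := hw.all hne hp
  have hN := hN N le_rfl
  set B := (substPow σ N 0).length + (substPow σ N 1).length with hB
  refine ⟨2 * B + 1, fun k => ?_⟩
  obtain ⟨N1, h1⟩ := ((hull_iff σ u).1 hu (2 * B + 1) k).all hne hp
  have h1 := h1 (N + N1) (by omega) 0
  rw [substPow_add] at h1
  obtain ⟨y, hy⟩ := block _ B (by intro y; fin_cases y <;> simp [hB]) _ _ h1 (by rw [C_len]; omega)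
  exact C_infix u ((hN y).trans hy)

theorem hull_nonempty {σ : Subst} (hne : NonErasing σ) (hp : Primitive σ) : ∃ u, u ∈ Hull σ := by
  let S : ℕ → Set (ℤ → A2) := fun n => {u | Lang σ (C u (2 * n) (-n))}
  have hcl : ∀ n, IsClosed (S n) := by
    intro n
    have hc : Continuous (fun u : ℤ → A2 => (fun i : Fin (2 * n) => u (-n + (i : ℕ)))) := by fun_prop
    have : S n = (fun u : ℤ → A2 => (fun i : Fin (2 * n) => u (-n + (i : ℕ)))) ⁻¹'
        {f | Lang σ (List.ofFn f)} := by
      ext u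
      simp only [S, Set.mem_ofPred_eq, Set.mem_preimage]
      have : C u (2 * n) (-n) = List.ofFn fun i : Fin (2 * n) => u (-n + (i : ℕ)) := by
        apply List.ext_getElem <;> simp [C]
      rw [this]
    rw [this]
    exact (isClosed_discrete _).preimage hc
  have hanti : ∀ n, S (n + 1) ⊆ S n := by
    intro n u hu
    refine Lang.infix hu ?_
    have : 2 * (n + 1) = 1 + (2 * n + 1) := by ring
    rw [this, C_add, C_add]
    refine ⟨C u 1 (-(n+1 : ℕ)), C u 1 (-(n+1:ℕ) + (1 : ℕ) + (2 * n : ℕ)), ?_⟩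
    have : (-(n : ℤ)) = -((n + 1 : ℕ) : ℤ) + (1 : ℕ) := by push_cast; ring
    rw [this, List.append_assoc]
  have hnon : ∀ n, (S n).Nonempty := by
    intro n
    obtain ⟨N, hN⟩ := growth σ hne hp (2 * n)
    refine ⟨fun z => ((substPow σ N 0)).getD (z + n).toNat 0, ?_⟩
    refine ⟨N, 0, ?_⟩
    have : C (fun z => ((substPow σ N 0)).getD (z + n).toNat 0) (2 * n) (-n) = (substPow σ N 0).take (2 * n) := by
      have := hN 0
      apply List.ext_getElem
      · simp [C]; omega
      · intro i h1 h2
        simp at h2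
        simp [C]
        rw [List.getElem?_eq_getElem (by omega)]; rfl
    rw [this]
    exact (List.take_prefix _ _).isInfix
  obtain ⟨u, hu⟩ := IsCompact.nonempty_iInter_of_sequence_nonempty_isCompact_isClosed S hanti hnon
    (hcl 0).isCompact hcl
  refine ⟨u, (hull_iff σ u).2 fun n k => ?_⟩
  rw [Set.mem_iInter] at hu
  have hm := hu (n + k.natAbs)
  refine Lang.infix hm ?_
  set m := n + k.natAbs
  have h1 : 2 * m = (k + m).toNat + (n + (2 * m - n - (k + m).toNat)) := by omega
  rw [h1, C_add, C_add]
  have h2 : -(m : ℤ) + ((k + m).toNat : ℕ) = k := by omega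
  rw [h2]
  exact ⟨_, _, by rw [List.append_assoc]⟩

end TwoSubst

namespace TwoSubst

def E (u : ℤ → A2) (n : ℕ) (i j : ℤ) : Prop := ∀ t : ℕ, t < n → u (i + t) = u (j + t)

def RS (u : ℤ → A2) (n : ℕ) (i : ℤ) : Prop := ∃ j, E u n i j ∧ u (i + n) ≠ u (j + n)
def LS (u : ℤ → A2) (n : ℕ) (i : ℤ) : Prop := ∃ j, E u n i j ∧ u (i - 1) ≠ u (j - 1)

theorem E.symm {u : ℤ → A2} {n : ℕ} {i j : ℤ} (h : E u n i j) : E u n j i := fun t ht => (h t ht).symm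
theorem E.trans {u : ℤ → A2} {n : ℕ} {i j k : ℤ} (h : E u n i j) (h' : E u n j k) : E u n i k :=
  fun t ht => (h t ht).trans (h' t ht)
theorem E.refl (u : ℤ → A2) (n : ℕ) (i : ℤ) : E u n i i := fun _ _ => rfl

theorem E.mono {u : ℤ → A2} {n m : ℕ} {i j : ℤ} (h : E u n i j) (hm : m ≤ n) : E u m i j :=
  fun t ht => h t (by omega)

theorem E.sub {u : ℤ → A2} {n m : ℕ} {i j : ℤ} (h : E u n i j) (s : ℕ) (hm : s + m ≤ n) :
    E u m (i + s) (j + s) := fun t ht => by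
  have := h (s + t) (by omega)
  push_cast at this
  rw [add_assoc, add_assoc]; exact this

theorem fin2_trans {x y z : A2} (h : x ≠ y) (h' : y ≠ z) : x = z := by
  fin_cases x <;> fin_cases y <;> fin_cases z <;> simp_all

theorem E_succ {u : ℤ → A2} {n : ℕ} {i j : ℤ} (h : E u n i j) (h' : u (i + n) = u (j + n)) :
    E u (n + 1) i j := fun t ht => by
  rcases Nat.lt_succ_iff_lt_or_eq.1 ht with h1 | rfl
  · exact h t h1
  · exact h'

theorem E_succ_left {u : ℤ → A2} {n : ℕ} {i j : ℤ} (h : E u n i j) (h' : u (i - 1) = u (j - 1)) :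
    E u (n + 1) (i - 1) (j - 1) := fun t ht => by
  cases t with
  | zero => simpa using h'
  | succ t =>
    have := h t (by omega)
    push_cast
    rw [show i - 1 + ((t : ℤ) + 1) = i + t by ring, show j - 1 + ((t : ℤ) + 1) = j + t by ring]
    exact this

theorem C_eq_iff {u : ℤ → A2} {n : ℕ} {i j : ℤ} : C u n i = C u n j ↔ E u n i j := C_eq u n i j

theorem RS.congr {u : ℤ → A2} {n : ℕ} {i j : ℤ} (h : RS u n i) (hE : E u n i j) : RS u n j := by
  obtain ⟨k, h1, h2⟩ := h
  by_cases h3 : u (j + n) = u (k + n)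
  · exact ⟨i, hE.symm, by rw [h3]; exact h2.symm⟩
  · exact ⟨k, hE.symm.trans h1, h3⟩

theorem LS.congr {u : ℤ → A2} {n : ℕ} {i j : ℤ} (h : LS u n i) (hE : E u n i j) : LS u n j := by
  obtain ⟨k, h1, h2⟩ := h
  by_cases h3 : u (j - 1) = u (k - 1)
  · exact ⟨i, hE.symm, by rw [h3]; exact h2.symm⟩
  · exact ⟨k, hE.symm.trans h1, h3⟩

theorem RS.sub {u : ℤ → A2} {n : ℕ} {i : ℤ} (s : ℕ) (h : RS u (s + n) i) : RS u n (i + s) := by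
  obtain ⟨j, h1, h2⟩ := h
  refine ⟨j + s, h1.sub s le_rfl, ?_⟩
  push_cast at h2
  rwa [add_assoc, add_assoc]

theorem LS.sub {u : ℤ → A2} {n m : ℕ} {i : ℤ} (h : LS u n i) (hm : m ≤ n) : LS u m i := by
  obtain ⟨j, h1, h2⟩ := h
  exact ⟨j, h1.mono hm, h2⟩

theorem E.rs {u : ℤ → A2} {n : ℕ} {i j : ℤ} (h : E u n i j) (h' : ¬ RS u n i) : u (i + n) = u (j + n) := by
  by_contra hc; exact h' ⟨j, h, hc⟩

theorem E.ls {u : ℤ → A2} {n : ℕ} {i j : ℤ} (h : E u n i j) (h' : ¬ LS u n i) : u (i - 1) = u (j - 1) := by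
  by_contra hc; exact h' ⟨j, h, hc⟩

theorem fin_words (u : ℤ → A2) (n : ℕ) : (Set.range (C u n)).Finite :=
  (List.finite_length_eq A2 n).subset (by rintro _ ⟨k, rfl⟩; exact C_len u n k)

theorem words_eq (u : ℤ → A2) (n : ℕ) : {w : List A2 | w.length = n ∧ IsFactor w u} = Set.range (C u n) := by
  ext w
  simp only [Set.mem_ofPred_eq, isFactor_iff, Set.mem_range]
  constructor
  · rintro ⟨rfl, k, h⟩; exact ⟨k, h.symm⟩
  · rintro ⟨k, rfl⟩; exact ⟨C_len u n k, k, by rw [C_len]⟩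

theorem ncard_pairs {α : Type} (T : Set (α × A2)) (hT : T.Finite) :
    T.ncard = (Prod.fst '' T).ncard + {x | (x, (0 : A2)) ∈ T ∧ (x, (1 : A2)) ∈ T}.ncard := by
  have h0 : {x | (x, (0 : A2)) ∈ T}.Finite := hT.preimage (by intro a _ b _ h; simpa using h)
  have h1 : {x | (x, (1 : A2)) ∈ T}.Finite := hT.preimage (by intro a _ b _ h; simpa using h)
  have e : Prod.fst '' T = {x | (x, (0 : A2)) ∈ T} ∪ {x | (x, (1 : A2)) ∈ T} := by
    ext x
    simp only [Set.mem_image, Prod.exists, exists_and_right, exists_eq_right, Set.mem_union, Set.mem_ofPred_eq, Fin.exists_fin_two]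
  have e2 : {x | (x, (0 : A2)) ∈ T ∧ (x, (1 : A2)) ∈ T} = {x | (x, (0 : A2)) ∈ T} ∩ {x | (x, (1 : A2)) ∈ T} := rfl
  have e3 : T = (fun x => (x, (0 : A2))) '' {x | (x, (0 : A2)) ∈ T} ∪ (fun x => (x, (1 : A2))) '' {x | (x, (1 : A2)) ∈ T} := by
    ext ⟨x, i⟩
    fin_cases i <;> simp
  rw [e, e2, Set.ncard_union_add_ncard_inter _ _ h0 h1]
  conv_lhs => rw [e3]
  rw [Set.ncard_union_eq ?_ (h0.image _) (h1.image _), Set.ncard_image_of_injective, Set.ncard_image_of_injective]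
  · intro a b h; simpa using h
  · intro a b h; simpa using h
  · rw [Set.disjoint_left]; rintro _ ⟨x, _, rfl⟩ ⟨y, _, h⟩; simp at h

theorem ncard_ext (u : ℤ → A2) (n : ℕ) (f : ℤ → A2) :
    (Set.range fun k => (C u n k, f k)).ncard =
      (Set.range (C u n)).ncard + (C u n '' {i | ∃ j, E u n i j ∧ f i ≠ f j}).ncard := by
  have hf : (Set.range fun k => (C u n k, f k)).Finite :=
    ((fin_words u n).prod (Set.toFinite (Set.univ : Set A2))).subset
      (by rintro _ ⟨k, rfl⟩; exact ⟨⟨k, rfl⟩, trivial⟩)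
  rw [ncard_pairs _ hf]
  congr 2
  · ext w; simp
  · ext w
    simp only [Set.mem_range, Prod.mk.injEq, Set.mem_ofPred_eq, Set.mem_image]
    constructor
    · rintro ⟨⟨i, h1, h2⟩, j, h3, h4⟩
      exact ⟨i, ⟨j, C_eq_iff.1 (h1.trans h3.symm), by rw [h2, h4]; decide⟩, h1⟩
    · rintro ⟨i, ⟨j, h1, h2⟩, h3⟩
      have h4 := C_eq_iff.2 h1
      have : ∀ x y : A2, x ≠ y → (x = 0 ∧ y = 1) ∨ (x = 1 ∧ y = 0) := by decide
      rcases this _ _ h2 with ⟨h5, h6⟩ | ⟨h5, h6⟩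
      · exact ⟨⟨i, h3, h5⟩, j, by rw [← h4, h3], h6⟩
      · exact ⟨⟨j, by rw [← h4, h3], h6⟩, i, h3, h5⟩

theorem image_one (u : ℤ → A2) (n : ℕ) (S : Set ℤ) :
    (C u n '' S).ncard = 1 ↔ (∃ i, i ∈ S) ∧ ∀ i j, i ∈ S → j ∈ S → E u n i j := by
  rw [Set.ncard_eq_one]
  constructor
  · rintro ⟨w, hw⟩
    have h1 : ∀ i ∈ S, C u n i = w := fun i hi => by
      have : C u n i ∈ C u n '' S := ⟨i, hi, rfl⟩
      rw [hw] at this; exact this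
    have h2 : w ∈ C u n '' S := by rw [hw]; rfl
    obtain ⟨i, hi, _⟩ := h2
    exact ⟨⟨i, hi⟩, fun i j hi hj => C_eq_iff.1 ((h1 i hi).trans (h1 j hj).symm)⟩
  · rintro ⟨⟨i, hi⟩, h⟩
    refine ⟨C u n i, ?_⟩
    ext w
    constructor
    · rintro ⟨j, hj, rfl⟩; exact C_eq_iff.2 (h j i hj hi)
    · rintro rfl; exact ⟨i, hi, rfl⟩

theorem rs_count (u : ℤ → A2) (n : ℕ) :
    (Set.range (C u (n + 1))).ncard = (Set.range (C u n)).ncard + 1 ↔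
      (∃ i, RS u n i) ∧ ∀ i j, RS u n i → RS u n j → E u n i j := by
  have h := ncard_ext u n (fun k => u (k + n))
  have h2 : (Set.range fun k => (C u n k, u (k + n))).ncard = (Set.range (C u (n + 1))).ncard := by
    have : Set.range (C u (n + 1)) = (fun p : List A2 × A2 => p.1 ++ [p.2]) '' (Set.range fun k => (C u n k, u (k + n))) := by
      rw [← Set.range_comp]
      congr 1
      funext k
      rw [C_add]; simp [C]
    rw [this, Set.ncard_image_of_injective]
    rintro ⟨a, b⟩ ⟨c, d⟩ h
    have := List.append_inj' h rfl
    simp at this; simp [this]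
  rw [h2] at h
  rw [h, Nat.add_left_cancel_iff, image_one]; rfl

theorem ls_count (u : ℤ → A2) (n : ℕ) :
    (Set.range (C u (n + 1))).ncard = (Set.range (C u n)).ncard + 1 ↔
      (∃ i, LS u n i) ∧ ∀ i j, LS u n i → LS u n j → E u n i j := by
  have h := ncard_ext u n (fun k => u (k - 1))
  have h2 : (Set.range fun k => (C u n k, u (k - 1))).ncard = (Set.range (C u (n + 1))).ncard := by
    have h0 : Set.range (C u (n + 1)) = Set.range (fun k => C u (n + 1) (k - 1)) :=
      ((Equiv.subRight (1 : ℤ)).surjective.range_comp (C u (n+1))).symm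
    have : Set.range (C u (n + 1)) = (fun p : List A2 × A2 => p.2 :: p.1) '' (Set.range fun k => (C u n k, u (k - 1))) := by
      rw [← Set.range_comp, h0]
      congr 1
      funext k
      rw [Nat.add_comm, C_add]; simp [C]
    rw [this, Set.ncard_image_of_injective]
    rintro ⟨a, b⟩ ⟨c, d⟩ h
    simp at h; simp [h]
  rw [h2] at h
  rw [h, Nat.add_left_cancel_iff, image_one]; rfl

theorem count_zero (u : ℤ → A2) : (Set.range (C u 0)).ncard = 1 := by
  have : C u 0 = fun _ => [] := by funext k; simp [C]
  rw [this, Set.range_const, Set.ncard_singleton]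

end TwoSubst

namespace TwoSubst

theorem substPow_succ' (σ : Subst) (n : ℕ) (x : A2) : substPow σ (n + 1) x = apply σ (substPow σ n x) := by
  have : substPow σ 1 = σ := by funext x; exact substPow_one σ x
  rw [Nat.add_comm, substPow_add, this]

theorem apply_succ' (σ : Subst) (n : ℕ) (w : List A2) :
    apply (substPow σ (n + 1)) w = apply σ (apply (substPow σ n) w) := by
  rw [← apply_comp]; congr 1; funext x; exact substPow_succ' σ n x

theorem conj_apply (σ τ : Subst) (t : List A2) (h : ∀ i, σ i ++ t = t ++ τ i) (w : List A2) :
    apply σ w ++ t = t ++ apply τ w := by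
  induction w with
  | nil => simp [apply_nil]
  | cons a w ih => rw [apply_cons, apply_cons, List.append_assoc, ih, ← List.append_assoc, h, List.append_assoc]

theorem conj_pow (σ τ : Subst) (t : List A2) (h : ∀ i, σ i ++ t = t ++ τ i) (N : ℕ) :
    ∃ p, ∀ w, apply (substPow σ N) w ++ p = p ++ apply (substPow τ N) w := by
  induction N with
  | zero =>
    have : ∀ σ w, apply (substPow σ 0) w = w := by
      intro σ w; rw [← iter_flat]; rfl
    exact ⟨[], fun w => by simp [this]⟩
  | succ N ih =>
    obtain ⟨p, hp⟩ := ih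
    refine ⟨apply σ p ++ t, fun w => ?_⟩
    rw [apply_succ', apply_succ', ← List.append_assoc, ← apply_append, hp, apply_append, List.append_assoc,
      conj_apply σ τ t h, List.append_assoc]

theorem bal_replicate (k : ℕ) (x : A2) : Bal (List.replicate k x) := by
  rintro p ⟨h1, h2⟩
  have h3 := List.eq_of_mem_replicate (h1.subset (List.mem_cons_self))
  have h4 := List.eq_of_mem_replicate (h2.subset (List.mem_cons_self))
  rw [← h3] at h4; exact absurd h4 (by decide)

theorem bal_pow (σ τ : Subst) (t : List A2) (h : ∀ i, σ i ++ t = t ++ τ i) (hs : Std (τ 0) (τ 1))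
    (hne : NonErasing σ) (N : ℕ) (x : A2) : Bal (substPow σ N x) := by
  have hb : ∀ N w, Bal w → Bal (apply (substPow τ N) w) := by
    intro N
    induction N with
    | zero => intro w hw; rw [← iter_flat]; exact hw
    | succ N ih =>
      intro w hw; rw [apply_succ']
      have := hs.bal _ (ih w hw)
      rwa [subst_eta] at this
  obtain ⟨p, hp⟩ := conj_pow σ τ t h N
  have hx : ∀ σ, apply (substPow σ N) [x] = substPow σ N x := by
    intro σ; rw [apply_cons, apply_nil, List.append_nil]
  have hlen : (substPow τ N x).length = (substPow σ N x).length := by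
    have := congrArg List.length (hp [x]); rw [hx, hx] at this; simp at this; omega
  have hpos := List.length_pos_iff.2 (substPow_ne σ hne N x)
  set k := (substPow σ N x).length + p.length with hk
  have hbk := hb N _ (bal_replicate (k + 1) x)
  refine hbk.infix ?_
  have h1 := hp (List.replicate (k + 1) x)
  have h2 : apply (substPow τ N) (List.replicate (k + 1) x) <:+
      apply (substPow σ N) (List.replicate (k + 1) x) ++ p := ⟨p, h1.symm⟩
  have h3 : substPow σ N x ++ p <:+ apply (substPow σ N) (List.replicate (k + 1) x) ++ p := by
    rw [List.replicate_succ', apply_append, hx, List.append_assoc]; exact List.suffix_append _ _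
  have h4 := List.suffix_of_suffix_length_le h3 h2 (by
    have := apply_len_ge (substPow τ N) 1 (fun y => by
      have := congrArg List.length (hp [y]); 
      have h5 := List.length_pos_iff.2 (substPow_ne σ hne N y)
      simp [apply_cons, apply_nil] at this; omega) (List.replicate (k + 1) x)
    rw [List.length_replicate] at this
    rw [List.length_append]; omega)
  exact (List.prefix_append _ _).isInfix.trans h4.isInfix

theorem RS.ex {u : ℤ → A2} {n : ℕ} {i : ℤ} (h : RS u n i) (x : A2) : ∃ j, E u n i j ∧ u (j + n) = x := by
  obtain ⟨k, h1, h2⟩ := h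
  by_cases h3 : u (i + n) = x
  · exact ⟨i, E.refl _ _ _, h3⟩
  · exact ⟨k, h1, (fin2_trans (Ne.symm h3) h2).symm⟩

theorem rs_unique {σ : Subst} (hne : NonErasing σ) (hp : Primitive σ) {u : ℤ → A2} (hu : u ∈ Hull σ)
    (hb : ∀ N x, Bal (substPow σ N x)) (n : ℕ) (i j : ℤ) (hi : RS u n i) (hj : RS u n j) : E u n i j := by
  have key : ∀ (i j : ℤ) (t : ℕ), t < n → RS u n i → RS u n j → u (i + t) = 0 → u (j + t) = 1 →
      (∀ s : ℕ, t < s → s < n → u (i + s) = u (j + s)) → False := by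
    intro i j t ht hi hj h0 h1 hs
    obtain ⟨i', hi1, hi2⟩ := hi.ex 0
    obtain ⟨j', hj1, hj2⟩ := hj.ex 1
    have hlang := (hull_iff σ u).1 hu
    have e : ∀ k : ℤ, C u (n - t + 1) (k + t) = u (k + t) :: (C u (n - t - 1) (k + t + 1) ++ [u (k + n)]) := by
      intro k
      have : n - t + 1 = 1 + ((n - t - 1) + 1) := by omega
      rw [this, C_add, C_add]
      have e1 : k + (t : ℤ) + (1 : ℕ) + ((n - t - 1 : ℕ) : ℤ) = k + n := by omega
      rw [e1]; simp [C]
    have a1 := hlang (n - t + 1) (i' + t)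
    have a2 := hlang (n - t + 1) (j' + t)
    rw [e, hi2, ← hi1 t ht, h0] at a1
    rw [e, hj2, ← hj1 t ht, h1] at a2
    have e3 : C u (n - t - 1) (i' + t + 1) = C u (n - t - 1) (j' + t + 1) := by
      rw [C_eq]
      intro s hs'
      have b1 := hi1 (t + 1 + s) (by omega)
      have b2 := hj1 (t + 1 + s) (by omega)
      have b3 := hs (t + 1 + s) (by omega) (by omega)
      push_cast at b1 b2 b3
      simp only [← add_assoc] at b1 b2 b3
      rw [← b1, ← b2, b3]
    rw [← e3] at a2
    obtain ⟨N1, c1⟩ := a1.all hne hp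
    obtain ⟨N2, c2⟩ := a2.all hne hp
    exact hb (N1 + N2) 0 _ ⟨c1 (N1 + N2) (by omega) 0, c2 (N1 + N2) (by omega) 0⟩
  -- last disagreement
  by_contra hE
  have hex : ∃ d, d < n ∧ u (i + ((n - 1 - d : ℕ) : ℤ)) ≠ u (j + ((n - 1 - d : ℕ) : ℤ)) := by
    simp only [E, not_forall] at hE
    obtain ⟨t, ht, h⟩ := hE
    exact ⟨n - 1 - t, by omega, by rw [show n - 1 - (n - 1 - t) = t by omega]; exact h⟩
  classical
  obtain ⟨hd1, hd2⟩ := Nat.find_spec hex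
  have hmin := fun m hm => Nat.find_min hex (m := m) hm
  set d := Nat.find hex
  have hs : ∀ s : ℕ, n - 1 - d < s → s < n → u (i + s) = u (j + s) := by
    intro s h1 h2
    have := hmin (n - 1 - s) (by omega)
    rw [show n - 1 - (n - 1 - s) = s by omega] at this
    by_contra hc
    exact this ⟨by omega, hc⟩
  have hc : ∀ x y : A2, x ≠ y → (x = 0 ∧ y = 1) ∨ (x = 1 ∧ y = 0) := by decide
  rcases hc _ _ hd2 with ⟨h5, h6⟩ | ⟨h5, h6⟩
  · exact key i j _ (by omega) hi hj h5 h6 hs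
  · exact key j i _ (by omega) hj hi h6 h5 (fun s a b => (hs s a b).symm)

theorem no_fixed {σ : Subst} (hp : Primitive σ) (x y : ℤ) (hx : 0 ≤ x) (hy : 0 ≤ y) (hxy : 0 < x + y)
    (h : M σ *ᵥ ![x, y] = ![x, y]) : False := by
  obtain ⟨n, hn, hpos⟩ := hp
  have : ∀ n, M σ ^ n *ᵥ ![x, y] = ![x, y] := by
    intro n
    induction n with
    | zero => simp
    | succ n ih => rw [pow_succ, ← Matrix.mulVec_mulVec, h, ih]
  have h1 := this n
  have h2 := congrFun h1 0
  have h3 := congrFun h1 1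
  simp [Matrix.mulVec, dotProduct, Fin.sum_univ_two] at h2 h3
  have := hpos 0 0
  have := hpos 0 1
  have := hpos 1 0
  have := hpos 1 1
  nlinarith

theorem root_eq (q s T δ : ℤ) (hq : 0 < q) (hs : 0 ≤ s) (hδ : δ ^ 2 = 1)
    (h : q ^ 2 * δ - q * s * T + s ^ 2 = 0) : s = q := by
  have hg : 0 < Int.gcd q s := Int.gcd_pos_of_ne_zero_left _ hq.ne'
  obtain ⟨q', s', hco, hq', hs'⟩ := Int.exists_gcd_one hg
  have hg0 : (0 : ℤ) < (Int.gcd q s : ℤ) := by exact_mod_cast hg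
  generalize (Int.gcd q s : ℤ) = g at *
  subst hq' hs'
  have h1 : q' ^ 2 * δ - q' * s' * T + s' ^ 2 = 0 := by
    have : g ^ 2 * (q' ^ 2 * δ - q' * s' * T + s' ^ 2) = 0 := by rw [← h]; ring
    exact (mul_eq_zero.1 this).resolve_left (by positivity)
  have hc : IsCoprime q' s' := Int.isCoprime_iff_gcd_eq_one.2 hco
  have hq1 : 0 < q' := by by_contra hh; nlinarith
  have hs1 : 0 ≤ s' := by by_contra hh; nlinarith
  have d1 : q' ∣ s' ^ 2 := ⟨s' * T - q' * δ, by linarith⟩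
  have d2 : s' ∣ q' ^ 2 := by
    refine ⟨(q' * T - s') * δ, ?_⟩
    have : q' ^ 2 * δ * δ = s' * (q' * T - s') * δ := by
      congr 1; linarith
    calc q' ^ 2 = q' ^ 2 * δ ^ 2 := by rw [hδ, mul_one]
      _ = _ := by linarith
  have u1 : IsUnit q' := (hc.pow_right).isUnit_of_dvd d1
  have u2 : IsUnit s' := (hc.symm.pow_right).isUnit_of_dvd d2
  rw [Int.isUnit_iff] at u1 u2
  have : q' = 1 := by omega
  have : s' = 1 := by omega
  simp [*]

theorem cnt_rot (u : ℤ → A2) (q : ℕ) (hq : ∀ s : ℕ, u s = u (q + s)) (i : A2) (m : ℕ) :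
    (C u q m).count i = (C u q 0).count i := by
  induction m with
  | zero => rfl
  | succ m ih =>
    rw [← ih]
    have h1 : C u (q + 1) m = C u q m ++ [u (m + q)] := by rw [C_add]; simp [C]
    have h2 : C u (q + 1) m = u m :: C u q (m + 1) := by rw [Nat.add_comm, C_add]; simp [C]
    have h3 := congrArg (List.count i) (h1.symm.trans h2)
    rw [List.count_append, List.count_cons, List.count_cons, List.count_nil, hq m, add_comm (m : ℤ) q] at h3
    push_cast
    omega

theorem cnt_mul (u : ℤ → A2) (q : ℕ) (hq : ∀ s : ℕ, u s = u (q + s)) (i : A2) (k m : ℕ) :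
    (C u (k * q) m).count i = k * (C u q 0).count i := by
  induction k generalizing m with
  | zero => simp [C]
  | succ k ih =>
    rw [Nat.succ_mul, C_add, List.count_append, ih]
    have := cnt_rot u q hq i (m + k * q)
    push_cast at this ⊢
    rw [this]; ring

theorem len_count (w : List A2) : w.length = w.count 0 + w.count 1 := by
  induction w with
  | nil => rfl
  | cons a w ih => fin_cases a <;> simp [ih] <;> omega

theorem rs_exists {σ : Subst} (hne : NonErasing σ) (hp : Primitive σ) {u : ℤ → A2} (hu : u ∈ Hull σ)
    (hdet : (M σ 0 0 * M σ 1 1 - M σ 0 1 * M σ 1 0) ^ 2 = 1) (n : ℕ) : ∃ i, RS u n i := by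
  by_contra hno
  push Not at hno
  have hlang := (hull_iff σ u).1 hu
  have hfut : ∀ i j, E u n i j → ∀ s : ℕ, E u (s + n) i j := by
    intro i j h s
    induction s with
    | zero => simpa using h
    | succ s ih =>
      rw [show s + 1 + n = s + n + 1 by ring]
      exact E_succ ih (ih.rs (fun hr => hno _ hr.sub))
  obtain ⟨R, hR⟩ := recur hne hp hu (hlang n 0)
  obtain ⟨j, hj1, -, hj3⟩ := hR 1
  rw [C_len] at hj3
  have hE := C_eq_iff.1 hj3
  obtain ⟨q, rfl⟩ := Int.eq_ofNat_of_zero_le (show 0 ≤ j by omega)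
  have hq : ∀ s : ℕ, u s = u (q + s) := fun s => by
    have := hfut _ _ hE (s + 1) s (by omega)
    simpa using this
  set P0 := (C u q 0).count 0 with hP0
  set P1 := (C u q 0).count 1 with hP1
  have hPq : q = P0 + P1 := by rw [hP0, hP1, ← len_count, C_len]
  set s := (apply σ (C u q 0)).length with hs
  have hw := (hlang (q * q) 0).apply
  have hcnt : ∀ i, ((apply σ (C u (q * q) 0)).count i : ℤ) = q * (M σ i 0 * P0 + M σ i 1 * P1) := by
    intro i
    rw [count_apply]
    have h0 := cnt_mul u q hq 0 q 0
    have h1 := cnt_mul u q hq 1 q 0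
    simp only [Nat.cast_zero] at h0 h1
    rw [h0, h1]; push_cast; ring
  have hscnt : (s : ℤ) = (M σ 0 0 * P0 + M σ 0 1 * P1) + (M σ 1 0 * P0 + M σ 1 1 * P1) := by
    rw [hs, len_count]; push_cast; rw [count_apply, count_apply]
  have hlen : (apply σ (C u (q * q) 0)).length = s * q := by
    have := len_count (apply σ (C u (q * q) 0))
    zify at this ⊢
    rw [this, hcnt, hcnt, hscnt]; ring
  obtain ⟨R', hR'⟩ := recur hne hp hu hw
  obtain ⟨m, hm0, -, hm⟩ := hR' 0
  obtain ⟨m, rfl⟩ := Int.eq_ofNat_of_zero_le hm0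
  rw [hlen] at hm
  have hc2 : ∀ i, ((apply σ (C u (q * q) 0)).count i : ℤ) = s * (C u q 0).count i := by
    intro i
    have := cnt_mul u q hq i s m
    rw [hm, this]; push_cast; ring
  have e0 := (hcnt 0).symm.trans (hc2 0)
  have e1 := (hcnt 1).symm.trans (hc2 1)
  rw [← hP0] at e0
  rw [← hP1] at e1
  have hq1 : (0 : ℤ) < q := by omega
  have hD : ((q : ℤ) ^ 2 * (M σ 0 0 * M σ 1 1 - M σ 0 1 * M σ 1 0) - q * s * (M σ 0 0 + M σ 1 1) + (s : ℤ) ^ 2) = 0 := by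
    have d0 : ((q : ℤ) ^ 2 * (M σ 0 0 * M σ 1 1 - M σ 0 1 * M σ 1 0) - q * s * (M σ 0 0 + M σ 1 1) + (s : ℤ) ^ 2) * P0 = 0 := by
      linear_combination (q * M σ 1 1 - s) * e0 - q * M σ 0 1 * e1
    have d1 : ((q : ℤ) ^ 2 * (M σ 0 0 * M σ 1 1 - M σ 0 1 * M σ 1 0) - q * s * (M σ 0 0 + M σ 1 1) + (s : ℤ) ^ 2) * P1 = 0 := by
      linear_combination (q * M σ 0 0 - s) * e1 - q * M σ 1 0 * e0
    have : ((q : ℤ) ^ 2 * (M σ 0 0 * M σ 1 1 - M σ 0 1 * M σ 1 0) - q * s * (M σ 0 0 + M σ 1 1) + (s : ℤ) ^ 2) * q = 0 := by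
      rw [show (q : ℤ) = P0 + P1 by exact_mod_cast hPq] at d0 d1 ⊢
      linear_combination d0 + d1
    exact (mul_eq_zero.1 this).resolve_right hq1.ne'
  have hsq : (s : ℤ) = q := root_eq q s _ _ hq1 (by positivity) hdet hD
  rw [hsq] at e0 e1
  have f0 := mul_left_cancel₀ hq1.ne' e0
  have f1 := mul_left_cancel₀ hq1.ne' e1
  refine no_fixed hp P0 P1 (by positivity) (by positivity) (by exact_mod_cast hPq ▸ hq1) ?_
  funext i
  fin_cases i
  · simpa [Matrix.mulVec, dotProduct, Fin.sum_univ_two] using f0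
  · simpa [Matrix.mulVec, dotProduct, Fin.sum_univ_two] using f1

theorem sturm_of_inv {σ : Subst} (hne : NonErasing σ) (hp : Primitive σ) (hi : IsInvertible σ)
    {u : ℤ → A2} (hu : u ∈ Hull σ) (n : ℕ) : (Set.range (C u n)).ncard = n + 1 := by
  obtain ⟨t, τ, hc, hs⟩ := std_of_invertible σ hne hi
  have hb := bal_pow σ τ t hc hs hne
  have hcount : ∀ i j, (τ j).count i = (σ j).count i := by
    intro i j
    have := congrArg (List.count i) (hc j)
    rw [List.count_append, List.count_append] at this
    omega
  have hdet : (M σ 0 0 * M σ 1 1 - M σ 0 1 * M σ 1 0) ^ 2 = 1 := by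
    have := hs.det
    simp only [hcount] at this
    exact this
  induction n with
  | zero => exact count_zero u
  | succ n ih =>
    rw [(rs_count u n).2 ⟨rs_exists hne hp hu hdet n, rs_unique hne hp hu hb n⟩, ih]

end TwoSubst

namespace TwoSubst

theorem exists_nonper {u : ℤ → A2} (F : ∀ n, (Set.range (C u n)).ncard = n + 1) (g : ℕ) (hg : 0 < g) :
    ∃ x, u x ≠ u (x + g) := by
  by_contra hno
  push Not at hno
  have hper : ∀ (m : ℕ) (x : ℤ), u (x + m * g) = u x := by
    intro m
    induction m with
    | zero => intro x; simp
    | succ m ih => intro x; rw [← ih x, hno (x + m * g)]; congr 1; push_cast; ring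
  have hper2 : ∀ (m x : ℤ), u (x + m * g) = u x := by
    intro m x
    obtain ⟨k, rfl | rfl⟩ := m.eq_nat_or_neg
    · exact hper k x
    · rw [← hper k (x + -(k : ℤ) * g)]; congr 1; ring
  have hsub : Set.range (C u g) ⊆ (fun k : ℕ => C u g k) '' (Finset.range g : Set ℕ) := by
    rintro _ ⟨k, rfl⟩
    have hg' : (0 : ℤ) < g := by exact_mod_cast hg
    have h1 := Int.emod_nonneg k hg'.ne'
    have h2 := Int.emod_lt_of_pos k hg'
    refine ⟨(k % g).toNat, ?_, ?_⟩
    · simp only [Finset.coe_range, Set.mem_Iio]; omega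
    · simp only
      rw [C_eq]
      intro t ht
      rw [Int.toNat_of_nonneg h1, ← hper2 (k / g)]
      congr 1
      have := Int.emod_add_mul_ediv k g
      linarith
  have h1 := Set.ncard_le_ncard hsub ((Finset.finite_toSet _).image _)
  have h2 := Set.ncard_image_le (f := fun k : ℕ => C u g k) (Finset.finite_toSet (Finset.range g))
  rw [Set.ncard_coe_finset, Finset.card_range] at h2
  rw [F g] at h1
  omega

theorem nonper {σ : Subst} (hne : NonErasing σ) (hp : Primitive σ) {u : ℤ → A2} (hu : u ∈ Hull σ)
    (F : ∀ n, (Set.range (C u n)).ncard = n + 1) (g : ℕ) (hg : 0 < g) :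
    ∃ N, ∀ i, ¬ E u N i (i + g) := by
  obtain ⟨x, hx⟩ := exists_nonper F g hg
  obtain ⟨R, hR⟩ := recur hne hp hu ((hull_iff σ u).1 hu (g + 1) x)
  refine ⟨R, fun i h => ?_⟩
  obtain ⟨j, h1, h2, h3⟩ := hR i
  rw [C_len] at h2 h3
  have h3 := C_eq_iff.1 h3
  have a0 := h3 0 (by omega)
  have a1 := h3 g (by omega)
  have a2 := h (j - i).toNat (by omega)
  rw [Int.toNat_of_nonneg (by omega)] at a2
  simp only [Nat.cast_zero, add_zero] at a0
  apply hx
  rw [a0, a1]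
  rw [show i + (j - i) = j by ring, show i + g + (j - i) = j + g by ring] at a2
  exact a2

theorem nonper_le {σ : Subst} (hne : NonErasing σ) (hp : Primitive σ) {u : ℤ → A2} (hu : u ∈ Hull σ)
    (F : ∀ n, (Set.range (C u n)).ncard = n + 1) (K : ℕ) :
    ∃ N, ∀ (i : ℤ) (g : ℕ), 0 < g → g ≤ K → ¬ E u N i (i + g) := by
  induction K with
  | zero => exact ⟨0, fun i g h1 h2 => by omega⟩
  | succ K ih =>
    obtain ⟨N, hN⟩ := ih
    obtain ⟨N', hN'⟩ := nonper hne hp hu F (K + 1) (by omega)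
    refine ⟨N + N', fun i g h1 h2 h => ?_⟩
    rcases Nat.lt_or_ge K g with h3 | h3
    · obtain rfl : g = K + 1 := by omega
      exact hN' i (h.mono (by omega))
    · exact hN i g h1 h3 (h.mono (by omega))

theorem bispecial {σ : Subst} (hne : NonErasing σ) (hp : Primitive σ) {u : ℤ → A2} (hu : u ∈ Hull σ)
    (F : ∀ n, (Set.range (C u n)).ncard = n + 1) (N : ℕ) : ∃ n, N ≤ n ∧ ∃ i, RS u n i ∧ LS u n i := by
  have hR : ∀ n, (∃ i, RS u n i) ∧ ∀ i j, RS u n i → RS u n j → E u n i j := fun n =>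
    (rs_count u n).1 (by rw [F, F])
  by_contra hno
  push Not at hno
  have hst : ∀ n, N ≤ n → ∀ i, RS u n i → RS u (n + 1) (i - 1) := by
    intro n hn i hi
    obtain ⟨k, hk⟩ := (hR (n + 1)).1
    have hk1 : RS u n (k + (1 : ℕ)) := RS.sub 1 (by rwa [Nat.add_comm])
    have hE := (hR n).2 _ _ hk1 hi
    have h1 := hE.ls (hno n hn _ hk1)
    have h2 := E_succ_left hE h1
    rw [show k + ((1 : ℕ) : ℤ) - 1 = k by push_cast; ring] at h2
    exact hk.congr h2
  have hst2 : ∀ (s : ℕ) i, RS u N i → RS u (N + s) (i - s) := by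
    intro s
    induction s with
    | zero => intro i hi; simpa using hi
    | succ s ih =>
      intro i hi
      have := hst _ (by omega) _ (ih i hi)
      rw [← add_assoc]; push_cast; rwa [← sub_sub]
  obtain ⟨i, hi⟩ := (hR N).1
  obtain ⟨R, hRR⟩ := recur hne hp hu ((hull_iff σ u).1 hu N i)
  obtain ⟨j, h1, h2, h3⟩ := hRR (i + 1)
  rw [C_len] at h3
  have hj : RS u N j := hi.congr (C_eq_iff.1 h3)
  obtain ⟨N', hN'⟩ := nonper hne hp hu F (j - i).toNat (by omega)
  refine hN' (i - N') ?_
  have := (hR _).2 _ _ (hst2 N' i hi) (hst2 N' j hj)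
  rw [Int.toNat_of_nonneg (by omega), show i - (N' : ℤ) + (j - i) = j - N' by ring]
  exact this.mono (by omega)

theorem next_occ {σ : Subst} (hne : NonErasing σ) (hp : Primitive σ) {u : ℤ → A2} (hu : u ∈ Hull σ)
    (n : ℕ) (k : ℤ) : ∃ p : ℕ, 0 < p ∧ E u n k (k + p) ∧ ∀ t : ℕ, 0 < t → t < p → ¬ E u n k (k + t) := by
  obtain ⟨R, hRR⟩ := recur hne hp hu ((hull_iff σ u).1 hu n k)
  obtain ⟨j, h1, h2, h3⟩ := hRR (k + 1)
  rw [C_len] at h3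
  have hex : ∃ p : ℕ, 0 < p ∧ E u n k (k + p) := ⟨(j - k).toNat, by omega, by
    rw [Int.toNat_of_nonneg (by omega), show k + (j - k) = j by ring]; exact C_eq_iff.1 h3⟩
  classical
  obtain ⟨a, b⟩ := Nat.find_spec hex
  exact ⟨Nat.find hex, a, b, fun t ht ht2 h => Nat.find_min hex ht2 ⟨ht, h⟩⟩

theorem loops {σ : Subst} (hne : NonErasing σ) (hp : Primitive σ) {u : ℤ → A2} (hu : u ∈ Hull σ)
    (F : ∀ n, (Set.range (C u n)).ncard = n + 1) (n : ℕ) (hn : 0 < n) (i0 : ℤ) (hr : RS u n i0) (hl : LS u n i0)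
    (k k' : ℤ) (p q : ℕ) (hk : E u n i0 k) (hk' : E u n i0 k') (hk0 : u (k + n) = 0) (hk1 : u (k' + n) = 1)
    (hp0 : 1 < p) (hq0 : 1 < q) (hp1 : E u n i0 (k + p)) (hq1 : E u n i0 (k' + q))
    (hp2 : ∀ t : ℕ, 0 < t → t < p → ¬ E u n i0 (k + t))
    (hq2 : ∀ t : ℕ, 0 < t → t < q → ¬ E u n i0 (k' + t)) :
    p + q = n + 2 ∧ ¬ E u n (k + (p - 1 : ℕ)) (k' + (q - 1 : ℕ)) := by
  have hR := ((rs_count u n).1 (by rw [F, F])).2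
  have hL := ((ls_count u n).1 (by rw [F, F])).2
  have step : ∀ x y, E u n x y → u (x + n) = u (y + n) → E u n (x + 1) (y + 1) := by
    intro x y h1 h2
    have := (E_succ h1 h2).sub 1 (m := n) (by omega)
    simpa using this
  have fwd : ∀ x y, E u n x y → ¬ E u n i0 x → E u n (x + 1) (y + 1) := by
    intro x y h1 h2
    exact step x y h1 (h1.rs fun h => h2 (hR _ _ hr h))
  have bwd : ∀ x y, E u n x y → ¬ E u n i0 x → E u n (x - 1) (y - 1) := by
    intro x y h1 h2
    exact (E_succ_left h1 (h1.ls fun h => h2 (hL _ _ hl h))).mono (by omega)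
  -- injectivity within a loop
  have inj1 : ∀ (k : ℤ) (p : ℕ), E u n i0 (k + p) → (∀ t : ℕ, 0 < t → t < p → ¬ E u n i0 (k + t)) →
      ∀ s t : ℕ, 0 < s → s < t → t ≤ p → ¬ E u n (k + s) (k + t) := by
    intro k p h1 h2 s t hs hst htp hE
    have : ∀ r : ℕ, t + r ≤ p → E u n (k + (s + r : ℕ)) (k + (t + r : ℕ)) := by
      intro r
      induction r with
      | zero => intro _; simpa using hE
      | succ r ih =>
        intro hr
        have := fwd _ _ (ih (by omega)) (h2 _ (by omega) (by omega))
        rw [add_assoc, add_assoc] at this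
        exact_mod_cast this
    have h3 := this (p - t) (by omega)
    rw [show t + (p - t) = p by omega] at h3
    exact h2 _ (by omega) (by omega) (h1.trans h3.symm)
  have inj2 : ∀ s t : ℕ, 0 < s → s ≤ p → 0 < t → t < q → ¬ E u n (k + s) (k' + t) := by
    intro s
    induction s with
    | zero => intro t h; omega
    | succ s ih =>
      intro t h1 h2 h3 h4 hE
      have hno := hq2 t h3 h4
      have hb := bwd _ _ hE (fun h => hno (h.trans hE))
      obtain ⟨t, rfl⟩ : ∃ r, t = r + 1 := ⟨t - 1, by omega⟩
      rw [show k + ((s + 1 : ℕ) : ℤ) - 1 = k + s by push_cast; ring,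
        show k' + ((t + 1 : ℕ) : ℤ) - 1 = k' + t by push_cast; ring] at hb
      rcases Nat.eq_zero_or_pos s with rfl | hs
      · rcases Nat.eq_zero_or_pos t with rfl | ht
        · have := hE (n - 1) (by omega)
          rw [show k + ((0 + 1 : ℕ) : ℤ) + ((n - 1 : ℕ) : ℤ) = k + n by omega,
            show k' + ((0 + 1 : ℕ) : ℤ) + ((n - 1 : ℕ) : ℤ) = k' + n by omega, hk0, hk1] at this
          exact absurd this (by decide)
        · refine hq2 t ht (by omega) (hk.trans ?_)
          simpa using hb
      · rcases Nat.eq_zero_or_pos t with rfl | ht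
        · refine hp2 s hs (by omega) (hk'.trans ?_)
          simpa using hb.symm
        · exact ih t hs (by omega) ht (by omega) hb
  refine ⟨?_, inj2 _ _ (by omega) (by omega) (by omega) (by omega)⟩
  let S : Set (List A2) := (fun s : ℕ => C u n (k + s)) '' (Finset.Ioc 0 p : Set ℕ)
  let S' : Set (List A2) := (fun s : ℕ => C u n (k' + s)) '' (Finset.Ioo 0 q : Set ℕ)
  have hS : S.ncard = p := by
    rw [Set.ncard_image_of_injOn, Set.ncard_coe_finset, Nat.card_Ioc, Nat.sub_zero]
    intro s hs t ht h
    simp only [Finset.coe_Ioc, Set.mem_Ioc] at hs ht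
    have h := C_eq_iff.1 h
    rcases lt_trichotomy s t with h3 | h3 | h3
    · exact absurd h (inj1 k p hp1 hp2 s t hs.1 h3 ht.2)
    · exact h3
    · exact absurd h.symm (inj1 k p hp1 hp2 t s ht.1 h3 hs.2)
  have hS' : S'.ncard = q - 1 := by
    rw [Set.ncard_image_of_injOn, Set.ncard_coe_finset, Nat.card_Ioo, Nat.sub_zero]
    intro s hs t ht h
    simp only [Finset.coe_Ioo, Set.mem_Ioo] at hs ht
    have h := C_eq_iff.1 h
    rcases lt_trichotomy s t with h3 | h3 | h3
    · exact absurd h (inj1 k' q hq1 hq2 s t hs.1 h3 ht.2.le)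
    · exact h3
    · exact absurd h.symm (inj1 k' q hq1 hq2 t s ht.1 h3 hs.2.le)
  have hdis : Disjoint S S' := by
    rw [Set.disjoint_left]
    rintro _ ⟨s, hs, rfl⟩ ⟨t, ht, h⟩
    simp only [Finset.coe_Ioc, Set.mem_Ioc, Finset.coe_Ioo, Set.mem_Ioo] at hs ht
    exact inj2 s t hs.1 hs.2 ht.1 ht.2 (C_eq_iff.1 h).symm
  have mS : ∀ z (s : ℕ), 0 < s → s ≤ p → E u n z (k + s) → C u n z ∈ S ∪ S' := by
    intro z s h1 h2 h3
    exact Or.inl ⟨s, by simp [h1, h2], (C_eq_iff.2 h3).symm⟩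
  have mS' : ∀ z (s : ℕ), 0 < s → s < q → E u n z (k' + s) → C u n z ∈ S ∪ S' := by
    intro z s h1 h2 h3
    exact Or.inr ⟨s, by simp [h1, h2], (C_eq_iff.2 h3).symm⟩
  have hsucc : ∀ z, C u n z ∈ S ∪ S' → C u n (z + 1) ∈ S ∪ S' := by
    rintro z (⟨s, hs, h⟩ | ⟨s, hs, h⟩)
    · simp only [Finset.coe_Ioc, Set.mem_Ioc] at hs
      have h := (C_eq_iff.1 h).symm
      rcases Nat.lt_or_ge s p with h1 | h1
      · have := (fwd _ _ h.symm (hp2 s hs.1 h1)).symm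
        refine mS (z + 1) (s + 1) (by omega) (by omega) ?_
        push_cast; rw [← add_assoc]; exact this
      · obtain rfl : s = p := by omega
        have hz : E u n i0 z := hp1.trans h.symm
        have hc : ∀ x : A2, x = 0 ∨ x = 1 := by decide
        rcases hc (u (z + n)) with h2 | h2
        · refine mS (z + 1) 1 (by omega) (by omega) ?_
          exact step z k (hz.symm.trans hk) (by rw [h2, hk0])
        · refine mS' (z + 1) 1 (by omega) (by omega) ?_
          exact step z k' (hz.symm.trans hk') (by rw [h2, hk1])
    · simp only [Finset.coe_Ioo, Set.mem_Ioo] at hs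
      have h := (C_eq_iff.1 h).symm
      have h5 := (fwd _ _ h.symm (hq2 s hs.1 hs.2)).symm
      rcases Nat.lt_or_ge (s + 1) q with h1 | h1
      · refine mS' (z + 1) (s + 1) (by omega) (by omega) ?_
        push_cast; rw [← add_assoc]; exact h5
      · obtain rfl : q = s + 1 := by omega
        refine mS (z + 1) p (by omega) le_rfl ?_
        push_cast at hq1
        rw [← add_assoc] at hq1
        exact (h5.trans hq1.symm).trans hp1
  have hcov : S ∪ S' = Set.range (C u n) := by
    apply Set.Subset.antisymm
    · rintro _ (⟨s, hs, rfl⟩ | ⟨s, hs, rfl⟩)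
      · exact ⟨_, rfl⟩
      · exact ⟨_, rfl⟩
    · rintro _ ⟨z, rfl⟩
      obtain ⟨R, hRR⟩ := recur hne hp hu ((hull_iff σ u).1 hu n i0)
      obtain ⟨j, h1, h2, h3⟩ := hRR (z - R)
      rw [C_len] at h3 h2
      have hj : C u n j ∈ S ∪ S' := mS j p (by omega) le_rfl ((C_eq_iff.1 h3).symm.trans hp1)
      have : ∀ d : ℕ, C u n (j + d) ∈ S ∪ S' := by
        intro d
        induction d with
        | zero => simpa using hj
        | succ d ih => have := hsucc _ ih; rw [add_assoc] at this; exact_mod_cast this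
      have h4 := this (z - j).toNat
      rw [Int.toNat_of_nonneg (by omega), show j + (z - j) = z by ring] at h4
      exact h4
  have hfin := F n
  rw [← hcov, Set.ncard_union_eq hdis ((Finset.finite_toSet _).image _) ((Finset.finite_toSet _).image _), hS, hS'] at hfin
  omega

theorem swap_pos {σ : Subst} (hne : NonErasing σ) (hp : Primitive σ) {u : ℤ → A2} (hu : u ∈ Hull σ)
    (F : ∀ n, (Set.range (C u n)).ncard = n + 1) (D : ℕ) :
    ∃ i j : ℤ, u i = 0 ∧ u (i + 1) = 1 ∧ u j = 1 ∧ u (j + 1) = 0 ∧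
      (∀ s : ℕ, 0 < s → s ≤ D → u (i - s) = u (j - s)) ∧
      (∀ s : ℕ, 0 < s → s ≤ D → u (i + 1 + s) = u (j + 1 + s)) := by
  obtain ⟨N, hN⟩ := nonper_le hne hp hu F (D + 3)
  obtain ⟨n, hn, i0, hr, hl⟩ := bispecial hne hp hu F (N + 1)
  obtain ⟨k, hk, hk0⟩ := hr.ex 0
  obtain ⟨k', hk', hk1⟩ := hr.ex 1
  obtain ⟨p, hp0, hp1, hp2⟩ := next_occ hne hp hu n k
  obtain ⟨q, hq0, hq1, hq2⟩ := next_occ hne hp hu n k'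
  have hpD : D + 3 < p := by
    by_contra h; exact hN k p hp0 (by omega) (hp1.mono (by omega))
  have hqD : D + 3 < q := by
    by_contra h; exact hN k' q hq0 (by omega) (hq1.mono (by omega))
  obtain ⟨hpq, hdist⟩ := loops hne hp hu F n (by omega) i0 hr hl k k' p q hk hk' hk0 hk1 (by omega) (by omega)
    (hk.trans hp1) (hk'.trans hq1) (fun t h1 h2 h3 => hp2 t h1 h2 (hk.symm.trans h3))
    (fun t h1 h2 h3 => hq2 t h1 h2 (hk'.symm.trans h3))
  have perp : ∀ t : ℕ, p + t < n → u (i0 + (p + t : ℕ)) = u (i0 + t) := by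
    intro t ht
    have h1 := hk (p + t) ht
    have h2 := (hk.trans hp1) t (by omega)
    rw [h1, h2]; congr 1; push_cast; ring
  have perq : ∀ t : ℕ, q + t < n → u (i0 + (q + t : ℕ)) = u (i0 + t) := by
    intro t ht
    have h1 := hk' (q + t) ht
    have h2 := (hk'.trans hq1) t (by omega)
    rw [h1, h2]; congr 1; push_cast; ring
  have w0 : u (i0 + (q - 2 : ℕ)) = 0 := by
    rw [(hk.trans hp1) (q - 2) (by omega), ← hk0]; congr 1; omega
  have w1 : u (i0 + (p - 2 : ℕ)) = 1 := by
    rw [(hk'.trans hq1) (p - 2) (by omega), ← hk1]; congr 1; omega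
  have wd : u (i0 + (p - 1 : ℕ)) ≠ u (i0 + (q - 1 : ℕ)) := by
    intro h
    apply hdist
    intro t ht
    cases t with
    | zero =>
      have a := hk (p - 1) (by omega)
      have b := hk' (q - 1) (by omega)
      simp only [Nat.cast_zero, add_zero]
      rw [← a, ← b, h]
    | succ t =>
      have a := (hk.trans hp1) t (by omega)
      have b := (hk'.trans hq1) t (by omega)
      rw [show k + ((p - 1 : ℕ) : ℤ) + ((t + 1 : ℕ) : ℤ) = k + p + t by omega,
        show k' + ((q - 1 : ℕ) : ℤ) + ((t + 1 : ℕ) : ℤ) = k' + q + t by omega, ← a, ← b]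
  have change : ∀ x : A2, ∃ z, u z = x ∧ u (z + 1) ≠ x := by
    intro x
    by_contra hno
    push Not at hno
    obtain ⟨N1, hN1⟩ := nonper hne hp hu F 1 (by omega)
    have hx : ∃ z, u z = x := by
      have hc : ∀ x : A2, x = 0 ∨ x = 1 := by decide
      rcases hc x with rfl | rfl
      · exact ⟨_, w0⟩
      · exact ⟨_, w1⟩
    obtain ⟨z, hz⟩ := hx
    have : ∀ d : ℕ, u (z + d) = x := by
      intro d
      induction d with
      | zero => simpa using hz
      | succ d ih => have := hno _ ih; rw [add_assoc] at this; exact_mod_cast this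
    refine hN1 z fun t ht => ?_
    rw [this, add_assoc, show ((1 : ℕ) : ℤ) + (t : ℤ) = ((1 + t : ℕ) : ℤ) by push_cast; ring, this]
  have wp : u (i0 + (p - 1 : ℕ)) = 0 := by
    by_contra hc
    have hc1 : ∀ x y : A2, x ≠ 0 → x ≠ y → x = 1 ∧ y = 0 := by decide
    obtain ⟨c1, c2⟩ := hc1 _ _ hc wd
    have mk : ∀ (x : A2) (y : ℤ), u y = x → u (y + 1) = x → RS u 1 y := by
      intro x y h1 h2
      obtain ⟨z, h3, h4⟩ := change x
      refine ⟨z, fun t ht => ?_, ?_⟩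
      · obtain rfl : t = 0 := by omega
        simp [h1, h3]
      · simp only [Nat.cast_one]; rw [h2]; exact h4.symm
    have r1 := mk 1 _ w1 (by rw [← c1]; congr 1; omega)
    have r0 := mk 0 _ w0 (by rw [← c2]; congr 1; omega)
    have := ((rs_count u 1).1 (by rw [F, F])).2 _ _ r1 r0 0 (by omega)
    simp only [Nat.cast_zero, add_zero] at this
    rw [w1, w0] at this
    exact absurd this (by decide)
  have wq : u (i0 + (q - 1 : ℕ)) = 1 := by
    have hc1 : ∀ x y : A2, x = 0 → x ≠ y → y = 1 := by decide
    exact hc1 _ _ wp wd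
  refine ⟨i0 + (q - 2 : ℕ), i0 + (p - 2 : ℕ), w0, ?_, w1, ?_, ?_, ?_⟩
  · rw [← wq]; congr 1; omega
  · rw [← wp]; congr 1; omega
  · intro s hs hsD
    have a := perp (q - 2 - s) (by omega)
    have b := perq (p - 2 - s) (by omega)
    rw [show i0 + ((q - 2 : ℕ) : ℤ) - s = i0 + (q - 2 - s : ℕ) by omega,
      show i0 + ((p - 2 : ℕ) : ℤ) - s = i0 + (p - 2 - s : ℕ) by omega, ← a, ← b]
    congr 2; omega
  · intro s hs hsD
    have a := perp (s - 1) (by omega)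
    have b := perq (s - 1) (by omega)
    rw [show i0 + ((q - 2 : ℕ) : ℤ) + 1 + s = i0 + (q + (s - 1) : ℕ) by omega,
      show i0 + ((p - 2 : ℕ) : ℤ) + 1 + s = i0 + (p + (s - 1) : ℕ) by omega, a, b]

end TwoSubst

namespace TwoSubst

theorem uv_ne {σ : Subst} (hne : NonErasing σ) (hp : Primitive σ) {u : ℤ → A2} (hu : u ∈ Hull σ)
    (F : ∀ n, (Set.range (C u n)).ncard = n + 1) : σ 0 ++ σ 1 ≠ σ 1 ++ σ 0 := by
  intro hc
  have hcomm : ∀ w, σ 0 ++ apply σ w = apply σ w ++ σ 0 := by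
    intro w
    induction w with
    | nil => simp [apply_nil]
    | cons a w ih =>
      rw [apply_cons, List.append_assoc, ← ih]
      fin_cases a
      · simp
      · simp only [Fin.mk_one]; rw [← List.append_assoc, hc, List.append_assoc]
  set g := (σ 0).length with hg
  have hg0 : 0 < g := List.length_pos_iff.2 (hne 0)
  obtain ⟨N, hN⟩ := nonper hne hp hu F g hg0
  have hX := ((hull_iff σ u).1 hu (N + g) 0).apply
  have hlen : N + g ≤ (apply σ (C u (N + g) 0)).length := by
    have := apply_len_ge σ 1 (fun x => List.length_pos_iff.2 (hne x)) (C u (N + g) 0)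
    rw [C_len] at this; omega
  have hcX := hcomm (C u (N + g) 0)
  generalize apply σ (C u (N + g) 0) = X at *
  obtain ⟨R, hR⟩ := recur hne hp hu hX
  obtain ⟨j, -, -, hj⟩ := hR 0
  refine hN j fun t ht => ?_
  have get : ∀ s : ℕ, s < X.length → X[s]? = some (u (j + s)) := by
    intro s hs
    rw [hj]; simp [C, hs]
  have h1 := get t (by omega)
  have h2 := get (g + t) (by omega)
  have h3 : (σ 0 ++ X)[g + t]? = (X ++ σ 0)[g + t]? := by rw [hcX]
  rw [List.getElem?_append_right (by omega), List.getElem?_append_left (by omega), ← hg,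
    show g + t - g = t by omega, h1, h2] at h3
  have := Option.some.inj h3
  rw [this]; congr 1; push_cast; ring

theorem inv_of_sturm {σ : Subst} (hne : NonErasing σ) (hp : Primitive σ) {u : ℤ → A2} (hu : u ∈ Hull σ)
    (F : ∀ n, (Set.range (C u n)).ncard = n + 1) : IsInvertible σ := by
  have hRU := fun n => ((rs_count u n).1 (by rw [F, F])).2
  have hlang := (hull_iff σ u).1 hu
  obtain ⟨t, x, y, r, r', hxy, h1, h2⟩ := exists_lcp (σ 0 ++ σ 1) (σ 1 ++ σ 0) (by simp; omega)
    (uv_ne hne hp hu F)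
  set l := (σ 0 ++ σ 1).length with hl
  have hl' : (σ 1 ++ σ 0).length = l := by simp [hl]; omega
  obtain ⟨N, hN⟩ := nonper_le hne hp hu F l
  obtain ⟨i, j, hi0, hi1, hj1, hj0, hleft, -⟩ := swap_pos hne hp hu F N
  have hZ : C u N (i - N) = C u N (j - N) := by
    rw [C_eq]; intro s hs
    have := hleft (N - s) (by omega) (by omega)
    rw [show i - (N : ℤ) + s = i - (N - s : ℕ) by omega, show j - (N : ℤ) + s = j - (N - s : ℕ) by omega]
    exact this
  have a1 := (hlang (N + 2) (i - N)).apply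
  have a2 := (hlang (N + 2) (j - N)).apply
  have e1 : apply σ (C u (N + 2) (i - N)) = apply σ (C u N (i - N)) ++ (σ 0 ++ σ 1) := by
    rw [C_add, apply_append]
    congr 1
    simp [C, List.range_succ, hi0, hi1, apply]
  have e2 : apply σ (C u (N + 2) (j - N)) = apply σ (C u N (i - N)) ++ (σ 1 ++ σ 0) := by
    rw [C_add, apply_append, hZ]
    congr 1
    simp [C, List.range_succ, hj0, hj1, apply]
  rw [e1] at a1
  rw [e2] at a2
  have hz : N ≤ (apply σ (C u N (i - N))).length := by
    have := apply_len_ge σ 1 (fun x => List.length_pos_iff.2 (hne x)) (C u N (i - N))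
    rw [C_len] at this; omega
  generalize apply σ (C u N (i - N)) = Z at *
  set z := Z.length with hzd
  obtain ⟨R1, hR1⟩ := recur hne hp hu a1
  obtain ⟨I, -, -, hI⟩ := hR1 0
  obtain ⟨R2, hR2⟩ := recur hne hp hu a2
  obtain ⟨J, -, -, hJ⟩ := hR2 0
  rw [List.length_append, ← hl, ← hzd, C_add] at hI
  rw [List.length_append, hl', ← hzd, C_add] at hJ
  obtain ⟨hI1, hI2⟩ := List.append_inj hI (by rw [C_len])
  obtain ⟨hJ1, hJ2⟩ := List.append_inj hJ (by rw [C_len])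
  have hlt : l = t.length + (1 + r.length) := by rw [hl, h1]; simp; omega
  have hlt' : l = t.length + (1 + r'.length) := by rw [← hl', h2]; simp; omega
  have hrpos : 0 < r.length := by
    by_contra h
    have hr : r = [] := List.length_eq_zero_iff.1 (by omega)
    have hr' : r' = [] := List.length_eq_zero_iff.1 (by omega)
    have c1 := congrArg (List.count x) h1
    have c2 := congrArg (List.count x) h2
    rw [hr] at c1; rw [hr'] at c2
    simp only [List.count_append, List.count_cons, List.count_nil] at c1 c2
    simp [hxy.symm] at c1 c2
    omega
  have split : ∀ K : ℤ, C u l (K + z) = C u t.length (K + z) ++ u (K + (z + t.length : ℕ)) ::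
      u (K + (z + t.length + 1 : ℕ)) :: C u (r.length - 1) (K + (z + t.length + 2 : ℕ)) := by
    intro K
    have : l = t.length + (2 + (r.length - 1)) := by omega
    rw [this, C_add, C_add]
    congr 1
    have : C u 2 (K + z + t.length) = [u (K + (z + t.length : ℕ)), u (K + (z + t.length + 1 : ℕ))] := by
      simp [C, List.range_succ, add_assoc]
    rw [this, List.cons_append, List.cons_append, List.nil_append]
    congr 3
    push_cast; ring
  rw [split] at hI2 hJ2
  set m := z + t.length with hm
  obtain ⟨ht1, hx⟩ := List.append_inj (h1.symm.trans hI2) (by rw [C_len])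
  obtain ⟨ht2, hy⟩ := List.append_inj (h2.symm.trans hJ2) (by rw [C_len])
  have hx := (List.cons.inj hx).1
  have hy := (List.cons.inj hy).1
  have hEIJ : E u m I J := by
    have b1 : C u m I = Z ++ t := by rw [hm, C_add, ← hI1, ← ht1]
    have b2 : C u m J = Z ++ t := by rw [hm, C_add, ← hJ1, ← ht2]
    exact C_eq_iff.1 (b1.trans b2.symm)
  have hRI : RS u m I := ⟨J, hEIJ, by rw [← hx, ← hy]; exact hxy⟩
  have hRJ : RS u m J := hRI.congr hEIJ
  have hPQ : ∃ P Q : ℤ, RS u m P ∧ RS u m Q ∧ u (P + m) = x ∧ u (P + (m + 1 : ℕ)) = y ∧ u (Q + m) = y ∧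
      u (Q + (m + 1 : ℕ)) = x ∧ ∀ s : ℕ, s < l → u (P + (m + 2 + s : ℕ)) = u (Q + (m + 2 + s : ℕ)) := by
    obtain ⟨i2, j2, g1, g2, g3, g4, g5, g6⟩ := swap_pos hne hp hu F (m + l)
    have hE : E u m (i2 - m) (j2 - m) := by
      intro s hs
      have := g5 (m - s) (by omega) (by omega)
      rw [show i2 - (m : ℤ) + s = i2 - (m - s : ℕ) by omega, show j2 - (m : ℤ) + s = j2 - (m - s : ℕ) by omega]
      exact this
    have hr1 : RS u m (i2 - m) := ⟨_, hE, by
      rw [sub_add_cancel, sub_add_cancel, g1, g3]; decide⟩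
    have hr2 := hr1.congr hE
    have q1 : ∀ K : ℤ, K - m + (m + 1 : ℕ) = K + 1 := by intro K; push_cast; ring
    have q2 : ∀ s : ℕ, s < l → u (i2 - m + (m + 2 + s : ℕ)) = u (j2 - m + (m + 2 + s : ℕ)) := by
      intro s hs
      have := g6 (s + 1) (by omega) (by omega)
      rw [show i2 - (m : ℤ) + (m + 2 + s : ℕ) = i2 + 1 + (s + 1 : ℕ) by omega,
        show j2 - (m : ℤ) + (m + 2 + s : ℕ) = j2 + 1 + (s + 1 : ℕ) by omega]
      exact this
    have hc : ∀ x y : A2, x ≠ y → (x = 0 ∧ y = 1) ∨ (x = 1 ∧ y = 0) := by decide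
    rcases hc x y hxy with ⟨rfl, rfl⟩ | ⟨rfl, rfl⟩
    · exact ⟨_, _, hr1, hr2, by rw [sub_add_cancel, g1], by rw [q1, g2], by rw [sub_add_cancel, g3],
        by rw [q1, g4], q2⟩
    · exact ⟨_, _, hr2, hr1, by rw [sub_add_cancel, g3], by rw [q1, g4], by rw [sub_add_cancel, g1],
        by rw [q1, g2], fun s hs => (q2 s hs).symm⟩
  obtain ⟨P, Q, hP, hQ, p1, p2, p3, p4, p5⟩ := hPQ
  have ext : ∀ I P : ℤ, RS u m I → RS u m P → u (I + m) = u (P + m) →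
      ∀ d : ℕ, d < l → E u (m + (d + 1)) I P := by
    intro I P hI hP h d
    induction d with
    | zero => intro _; exact E_succ (hRU m _ _ hI hP) h
    | succ d ih =>
      intro hd
      have hE := ih (by omega)
      refine E_succ hE (hE.rs fun hr => ?_)
      have hr2 : RS u m (I + (d + 1 : ℕ)) := RS.sub (d + 1) (by rwa [Nat.add_comm])
      exact hN I (d + 1) (by omega) (by omega) ((hRU m _ _ hI hr2).mono (by omega))
  have xI := ext I P hRI hP (by rw [← hx, p1]) (l - 1) (by omega)
  have xJ := ext J Q hRJ hQ (by rw [← hy, p3]) (l - 1) (by omega)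
  have fI : u (I + (m + 1 : ℕ)) = y := by rw [xI _ (by omega), p2]
  have fJ : u (J + (m + 1 : ℕ)) = x := by rw [xJ _ (by omega), p4]
  have fs : C u (r.length - 1) (I + (m + 2 : ℕ)) = C u (r.length - 1) (J + (m + 2 : ℕ)) := by
    rw [C_eq]
    intro s hs
    have b1 := xI (m + 2 + s) (by omega)
    have b2 := xJ (m + 2 + s) (by omega)
    have b3 := p5 s (by omega)
    have q : ∀ K : ℤ, K + (m + 2 : ℕ) + s = K + (m + 2 + s : ℕ) := by
      intro K; push_cast; ring
    rw [q, q, b1, b2, b3]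
  rw [← ht1, ← hx, fI] at hI2
  rw [← ht2, ← hy, fJ, ← fs] at hJ2
  exact invertible_of_swap σ hne _ _ x y hxy hI2 hJ2

end TwoSubst

open TwoSubst in
/-- For a primitive substitution on two letters, every bi-infinite word
in the hull is Sturmian (exactly `n+1` factors of each length `n ≥ 1`) if and only if the
substitution is invertible (an automorphism of `F₂`). -/
theorem sturmian_iff_invertible (σ : Subst) (hne : NonErasing σ) (hprim : Primitive σ) :
    (∀ u ∈ Hull σ, ∀ n : ℕ, 1 ≤ n →
        {w : List A2 | w.length = n ∧ IsFactor w u}.ncard = n + 1) ↔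
      IsInvertible σ := by
  constructor
  · intro h
    obtain ⟨u, hu⟩ := hull_nonempty hne hprim
    refine inv_of_sturm hne hprim hu fun n => ?_
    rcases Nat.eq_zero_or_pos n with rfl | hn
    · exact count_zero u
    · rw [← words_eq]; exact h u hu n hn
  · intro h u hu n _
    rw [words_eq]; exact sturm_of_inv hne hprim h hu n
end

section
/- (Nielsen) Two automorphisms σ and ρ of the free group F₂ on two generators a, b have the same abelianised matrix (i.e., they induce the same endomorphism of the abelianisation ℤ² of F₂) if and only if there exists w ∈ F₂ such that σ = γ_w ∘ ρ, where γ_w is the inner automorphism x ↦ w x w⁻¹. -/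
open scoped Matrix

namespace NielsenF2

/-- length of the longest common prefix -/
def lcp {α : Type*} [DecidableEq α] : List α → List α → ℕ
  | a :: s, b :: t => if a = b then lcp s t + 1 else 0
  | _, _ => 0

theorem lcp_ultra {α : Type*} [DecidableEq α] (x y z : List α) :
    min (lcp x y) (lcp y z) ≤ lcp x z := by
  induction x generalizing y z with
  | nil => simp [lcp]
  | cons a s ih =>
    cases y with
    | nil => simp [lcp]
    | cons b t =>
      cases z with
      | nil => simp [lcp]
      | cons d r =>
        have := ih t r
        simp only [lcp]
        split_ifs <;> grind

theorem isReduced_invRev {L : List (A2 × Bool)} (h : FreeGroup.IsReduced L) :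
    FreeGroup.IsReduced (FreeGroup.invRev L) := by
  rw [FreeGroup.isReduced_iff_reduce_eq] at *
  rw [FreeGroup.reduce_invRev, h]

theorem norm_mk_red {L : List (A2 × Bool)} (h : FreeGroup.IsReduced L) :
    (FreeGroup.mk L).norm = L.length := by
  rw [FreeGroup.norm, FreeGroup.toWord_mk, h.reduce_eq]

theorem norm_lcp (x y : List (A2 × Bool)) (hx : FreeGroup.IsReduced x)
    (hy : FreeGroup.IsReduced y) :
    ((FreeGroup.mk x)⁻¹ * FreeGroup.mk y).norm + 2 * lcp x y = x.length + y.length := by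
  induction x generalizing y with
  | nil =>
    rw [← FreeGroup.one_eq_mk]
    simp [lcp, norm_mk_red hy]
  | cons a s ih =>
    cases y with
    | nil =>
      rw [← FreeGroup.one_eq_mk]
      rw [mul_one, FreeGroup.norm_inv_eq, norm_mk_red hx]
      simp [lcp]
    | cons b t =>
      by_cases hab : a = b
      · subst hab
        have h1 := ih t (hx.infix ⟨[a], [], by simp⟩) (hy.infix ⟨[a], [], by simp⟩)
        have : (FreeGroup.mk (a :: s))⁻¹ * FreeGroup.mk (a :: t)
            = (FreeGroup.mk s)⁻¹ * FreeGroup.mk t := by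
          have e : ∀ r : List (A2 × Bool),
              FreeGroup.mk (a :: r) = FreeGroup.mk [a] * FreeGroup.mk r := by
            intro r; rw [FreeGroup.mul_mk]; rfl
          rw [e s, e t]; group
        rw [this]
        simp only [lcp, if_true, List.length_cons]
        omega
      · have hr : FreeGroup.IsReduced (FreeGroup.invRev (a :: s) ++ (b :: t)) := by
          have h1 := isReduced_invRev hx
          unfold FreeGroup.IsReduced at *
          rw [List.isChain_append]
          refine ⟨h1, hy, ?_⟩
          intro p hp q hq
          simp [FreeGroup.invRev] at hp hq
          subst hp; subst hq
          intro h
          simp only at h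
          by_contra h2
          apply hab
          ext
          · simp [h]
          · simp at h2; simp [h2]
        rw [FreeGroup.inv_mk, FreeGroup.mul_mk, norm_mk_red hr]
        simp [lcp, hab]

/-- Gromov product in the Cayley tree -/
def gp (x y : FreeGroup A2) : ℕ := lcp x.toWord y.toWord

theorem gp_norm (x y : FreeGroup A2) : (x⁻¹ * y).norm + 2 * gp x y = x.norm + y.norm := by
  have := norm_lcp x.toWord y.toWord FreeGroup.isReduced_toWord FreeGroup.isReduced_toWord
  rwa [FreeGroup.mk_toWord, FreeGroup.mk_toWord] at this

theorem gp_ultra (x y z : FreeGroup A2) : min (gp x y) (gp y z) ≤ gp x z := lcp_ultra _ _ _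

theorem gp_comm (x y : FreeGroup A2) : gp x y = gp y x := by
  have h1 := gp_norm x y
  have h2 := gp_norm y x
  have : (x⁻¹ * y).norm = (y⁻¹ * x).norm := by
    rw [← FreeGroup.norm_inv_eq]; simp
  omega

theorem exists_prefix (y : FreeGroup A2) (k : ℕ) (hk : k ≤ y.norm) :
    ∃ p : FreeGroup A2, p.norm = k ∧ (p⁻¹ * y).norm = y.norm - k := by
  have hy : FreeGroup.IsReduced y.toWord := FreeGroup.isReduced_toWord
  refine ⟨FreeGroup.mk (y.toWord.take k), ?_, ?_⟩
  · rw [norm_mk_red (hy.infix (List.take_prefix _ _).isInfix), List.length_take]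
    exact min_eq_left hk
  · have : (FreeGroup.mk (y.toWord.take k))⁻¹ * y = FreeGroup.mk (y.toWord.drop k) := by
      rw [inv_mul_eq_iff_eq_mul, FreeGroup.mul_mk, List.take_append_drop, FreeGroup.mk_toWord]
    rw [this, norm_mk_red (hy.infix (List.drop_suffix _ _).isInfix), List.length_drop]
    rfl

theorem norm_sq (y : FreeGroup A2) (hy : y ≠ 1) : y.norm < (y * y).norm := by
  have h := FreeGroup.reduceCyclically.reduce_flatten_replicate
    (FreeGroup.isReduced_toWord (x := y)) 2
  rw [← FreeGroup.toWord_pow] at h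
  have h2 := congrArg List.length h
  have h3 := congrArg List.length
    (FreeGroup.reduceCyclically.conj_conjugator_reduceCyclically y.toWord)
  have h4 : (FreeGroup.reduceCyclically y.toWord).length ≠ 0 := by
    intro h5
    apply hy
    have h6 := FreeGroup.reduceCyclically.conj_conjugator_reduceCyclically y.toWord
    rw [List.length_eq_zero_iff.1 h5, List.append_nil] at h6
    rw [← FreeGroup.mk_toWord (x := y), ← h6, ← FreeGroup.mul_mk,
      ← FreeGroup.inv_mk, mul_inv_cancel]
  rw [← pow_two]
  rw [if_neg (by norm_num)] at h2
  simp only [List.length_append, List.length_flatten, List.map_replicate,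
    List.sum_replicate, smul_eq_mul, FreeGroup.invRev_length] at h2 h3
  unfold FreeGroup.norm
  omega

theorem gp_self_lt (y : FreeGroup A2) (hy : y ≠ 1) : 2 * gp y⁻¹ y < y.norm := by
  have h1 := gp_norm y⁻¹ y
  have h2 := norm_sq y hy
  rw [FreeGroup.norm_inv_eq, inv_inv] at h1
  omega

theorem gp_mul_left (g x y : FreeGroup A2) (h : gp g⁻¹ x + gp x⁻¹ y < x.norm) :
    gp (g * x)⁻¹ y = gp x⁻¹ y := by
  have h1 := gp_norm (g * x)⁻¹ x⁻¹
  have h2 := gp_norm g⁻¹ x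
  have h3 := gp_ultra (g * x)⁻¹ x⁻¹ y
  have h4 := gp_ultra x⁻¹ (g * x)⁻¹ y
  have h5 := gp_comm (g * x)⁻¹ x⁻¹
  simp only [inv_inv, FreeGroup.norm_inv_eq, mul_inv_cancel_right] at h1 h2
  omega

/-- key reduced-word estimate (local cancellation hypothesis) -/
theorem growth (f : FreeGroup A2 →* FreeGroup A2)
    (hf : ∀ s t r : A2 × Bool, (s.1 = t.1 → s.2 = t.2) → (t.1 = r.1 → t.2 = r.2) →
      gp (f (FreeGroup.mk [s]))⁻¹ (f (FreeGroup.mk [t])) +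
      gp (f (FreeGroup.mk [t]))⁻¹ (f (FreeGroup.mk [r])) < (f (FreeGroup.mk [t])).norm)
    (L : List (A2 × Bool)) : ∀ (s r : A2 × Bool), FreeGroup.IsReduced (r :: s :: L) →
      gp (f (FreeGroup.mk [r]))⁻¹ (f (FreeGroup.mk (s :: L))) =
        gp (f (FreeGroup.mk [r]))⁻¹ (f (FreeGroup.mk [s])) ∧
      L.length + 1 + gp (f (FreeGroup.mk [r]))⁻¹ (f (FreeGroup.mk [s])) ≤
        (f (FreeGroup.mk (s :: L))).norm := by
  induction L with
  | nil =>
    intro s r h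
    refine ⟨rfl, ?_⟩
    have h1 := hf r s s (by
      unfold FreeGroup.IsReduced at h
      simpa using h) (fun _ => rfl)
    simp only [List.length_nil]
    omega
  | cons t L ih =>
    intro s r h
    have hred := h
    unfold FreeGroup.IsReduced at h
    rw [List.isChain_cons_cons, List.isChain_cons_cons] at h
    obtain ⟨h1, h2, h3⟩ := h
    obtain ⟨i1, i2⟩ := ih t s (hred.infix ⟨[r], [], by simp⟩)
    have hh := hf r s t h1 h2
    have e : FreeGroup.mk (s :: t :: L) = FreeGroup.mk [s] * FreeGroup.mk (t :: L) := by
      rw [FreeGroup.mul_mk]; rfl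
    rw [e, map_mul]
    set X := f (FreeGroup.mk [s])
    set Y := f (FreeGroup.mk [t])
    set Z := f (FreeGroup.mk (t :: L))
    set W := f (FreeGroup.mk [r])
    have g1 := gp_mul_left Z⁻¹ X⁻¹ W⁻¹
    have c1 := gp_comm Z X⁻¹
    have c2 := gp_comm X W⁻¹
    have c3 := gp_comm (X * Z) W⁻¹
    have c4 := gp_norm X⁻¹ Z
    simp only [inv_inv, FreeGroup.norm_inv_eq, mul_inv_rev] at g1 c4
    have g2 := g1 (by omega)
    simp only [List.length_cons]
    omega

end NielsenF2
namespace NielsenF2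

section abstract_group
variable {G : Type*} [Group G] (e t l : G)

/-- sign elements -/
def IsSign (x : G) : Prop := x = 1 ∨ x = t ∨ x = e * t * e ∨ x = t * (e * t * e)

/-- elements of the form sign * positive * sign -/
def SPS (g : G) : Prop :=
  ∃ s p r, IsSign e t s ∧ p ∈ Submonoid.closure ({e, l} : Set G) ∧ IsSign e t r ∧ g = s * p * r

variable {e t l}

theorem sps_inv_l (he : e * e = 1)
    (h1 : t * l * t = l⁻¹) (h2 : l⁻¹ * e * l = t * e * l * e) (p : G)
    (hp : p ∈ Submonoid.closure ({e, l} : Set G)) :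
    (∃ s q r, IsSign e t s ∧ q ∈ Submonoid.closure ({e, l} : Set G) ∧ IsSign e t r ∧
      l⁻¹ * p = s * q * r) ∧
    (∃ s q r, IsSign e t s ∧ q ∈ Submonoid.closure ({e, l} : Set G) ∧ IsSign e t r ∧
      l⁻¹ * (e * p) = s * q * r) := by
  have me : e ∈ Submonoid.closure ({e, l} : Set G) := Submonoid.subset_closure (by simp)
  have ml : l ∈ Submonoid.closure ({e, l} : Set G) := Submonoid.subset_closure (by simp)
  induction hp using Submonoid.closure_induction_left with
  | one =>
    constructor
    · exact ⟨t, l, t, Or.inr (Or.inl rfl), ml, Or.inr (Or.inl rfl), by rw [mul_one, h1]⟩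
    · refine ⟨t, l * e, e * t * e, Or.inr (Or.inl rfl), mul_mem ml me,
        Or.inr (Or.inr (Or.inl rfl)), ?_⟩
      rw [mul_one, ← h1]
      calc t * l * t * e = t * l * 1 * t * e := by group
        _ = _ := by rw [← he]; group
  | mul_left x hx q hq ih =>
    obtain ⟨i1, i2⟩ := ih
    rcases hx with rfl | rfl
    · refine ⟨i2, ?_⟩
      rw [← mul_assoc x x q, he, one_mul]
      exact i1
    · constructor
      · exact ⟨1, q, 1, Or.inl rfl, hq, Or.inl rfl, by group⟩
      · refine ⟨t, e * (x * (e * q)), 1, Or.inr (Or.inl rfl),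
          mul_mem me (mul_mem ml (mul_mem me hq)), Or.inl rfl, ?_⟩
        have : x⁻¹ * (e * (x * q)) = (x⁻¹ * e * x) * q := by group
        rw [this, h2]; group

theorem sps_all (he : e * e = 1) (ht : t * t = 1)
    (hc : t * (e * t * e) = (e * t * e) * t)
    (h1 : t * l * t = l⁻¹) (h2 : l⁻¹ * e * l = t * e * l * e)
    (h3 : l * (t * (e * t * e)) = (t * (e * t * e)) * l) (g : G)
    (hg : g ∈ Subgroup.closure ({e, t, l} : Set G)) : SPS e t l g := by
  have me : e ∈ Submonoid.closure ({e, l} : Set G) := Submonoid.subset_closure (by simp)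
  have ml : l ∈ Submonoid.closure ({e, l} : Set G) := Submonoid.subset_closure (by simp)
  have ei : e⁻¹ = e := inv_eq_of_mul_eq_one_left he
  have ti : t⁻¹ = t := inv_eq_of_mul_eq_one_left ht
  have u2 : (e * t * e) * (e * t * e) = 1 := by
    calc (e * t * e) * (e * t * e) = e * t * (e * e) * t * e := by group
      _ = e * (t * t) * e := by rw [he]; group
      _ = 1 := by rw [ht, mul_one, he]
  have tt : ∀ x, t * (t * x) = x := fun x => by rw [← mul_assoc, ht, one_mul]
  have ee : ∀ x, e * (e * x) = x := fun x => by rw [← mul_assoc, he, one_mul]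
  have st : ∀ s, IsSign e t s → IsSign e t (t * s) := by
    rintro s (rfl | rfl | rfl | rfl)
    · right; left; simp
    · left; exact ht
    · right; right; right; rfl
    · right; right; left; exact tt _
  have hE : ∀ g, SPS e t l g → SPS e t l (e * g) := by
    rintro g ⟨s, p, r, hs, hp, hr, rfl⟩
    refine ⟨e * s * e, e * p, r, ?_, mul_mem me hp, hr, ?_⟩
    · rcases hs with rfl | rfl | rfl | rfl
      · left; simp [he]
      · right; right; left; rfl
      · right; left
        simp only [mul_assoc, he, mul_one, ee]
      · right; right; right
        rw [hc]
        simp only [mul_assoc, ee]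
        simpa only [mul_assoc] using hc
    · simp only [mul_assoc, ee]
  have hT : ∀ g, SPS e t l g → SPS e t l (t * g) := by
    rintro g ⟨s, p, r, hs, hp, hr, rfl⟩
    exact ⟨t * s, p, r, st s hs, hp, hr, by group⟩
  have hrm : ∀ g r, SPS e t l g → IsSign e t r → SPS e t l (g * r) := by
    rintro g r ⟨s, p, r', hs, hp, hr', rfl⟩ hr
    refine ⟨s, p, r' * r, hs, hp, ?_, by group⟩
    rcases hr' with rfl | rfl | rfl | rfl
    · simpa using hr
    · exact st _ hr
    · rcases hr with rfl | rfl | rfl | rfl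
      · right; right; left; simp
      · right; right; right; exact hc.symm
      · left; exact u2
      · right; left
        rw [hc, ← mul_assoc, u2, one_mul]
    · rw [mul_assoc]
      apply st
      rcases hr with rfl | rfl | rfl | rfl
      · right; right; left; simp
      · right; right; right; exact hc.symm
      · left; exact u2
      · right; left
        rw [hc, ← mul_assoc, u2, one_mul]
  have hL0 : ∀ p ∈ Submonoid.closure ({e, l} : Set G), SPS e t l (l⁻¹ * p) := by
    intro p hp
    exact (sps_inv_l he h1 h2 p hp).1
  have hT2 : ∀ g, SPS e t l g → SPS e t l ((e * t * e) * g) := by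
    intro g hg
    have := hE _ (hT _ (hE _ hg))
    simpa only [mul_assoc] using this
  have lt : l * t = t * l⁻¹ := by rw [← h1, mul_assoc, tt]
  have hL : ∀ g, SPS e t l g → SPS e t l (l * g) := by
    rintro g ⟨s, p, r, hs, hp, hr, rfl⟩
    rw [← mul_assoc]
    apply hrm _ _ _ hr
    rcases hs with rfl | rfl | rfl | rfl
    · exact ⟨1, l * p, 1, Or.inl rfl, mul_mem ml hp, Or.inl rfl, by group⟩
    · rw [← mul_assoc, lt, mul_assoc]
      exact hT _ (hL0 p hp)
    · have : l * ((e * t * e) * p) = t * ((e * t * e) * (t * (l⁻¹ * p))) := by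
        have h4 : l * (e * t * e) = (l * (t * (e * t * e))) * t := by
          rw [hc]
          simp only [mul_assoc, ht, mul_one]
        rw [← mul_assoc, h4, h3, mul_assoc, mul_assoc, ← mul_assoc l t p, lt]
        simp only [mul_assoc]
      rw [this]
      exact hT _ (hT2 _ (hT _ (hL0 p hp)))
    · rw [← mul_assoc, h3]
      exact ⟨_, l * p, 1, Or.inr (Or.inr (Or.inr rfl)), mul_mem ml hp, Or.inl rfl, by group⟩
  induction hg using Subgroup.closure_induction_left with
  | one => exact ⟨1, 1, 1, Or.inl rfl, one_mem _, Or.inl rfl, by simp⟩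
  | mul_left x hx y hy ih =>
    rcases hx with rfl | rfl | rfl
    · exact hE _ ih
    · exact hT _ ih
    · exact hL _ ih
  | inv_mul_cancel x hx y hy ih =>
    rcases hx with rfl | rfl | rfl
    · rw [ei]; exact hE _ ih
    · rw [ti]; exact hT _ ih
    · rw [← h1]
      have := hT _ (hL _ (hT _ ih))
      simpa only [mul_assoc] using this

end abstract_group
end NielsenF2
namespace NielsenF2

/-- first generator -/
abbrev ga : FreeGroup A2 := FreeGroup.of 0
/-- second generator -/
abbrev gb : FreeGroup A2 := FreeGroup.of 1

/-- the endomorphism with given images -/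
def hom2 (u v : FreeGroup A2) : FreeGroup A2 →* FreeGroup A2 := FreeGroup.lift ![u, v]

@[simp] theorem hom2_a (u v : FreeGroup A2) : hom2 u v (FreeGroup.of 0) = u := by simp [hom2]
@[simp] theorem hom2_b (u v : FreeGroup A2) : hom2 u v (FreeGroup.of 1) = v := by simp [hom2]

theorem hom_ext2 {H : Type*} [Group H] {f g : FreeGroup A2 →* H} (h0 : f ga = g ga)
    (h1 : f gb = g gb) : f = g := by
  ext i
  fin_cases i
  · exact h0
  · exact h1

theorem aut_ext2 {f g : MulAut (FreeGroup A2)} (h0 : f ga = g ga) (h1 : f gb = g gb) :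
    f = g := by
  have : f.toMonoidHom = g.toMonoidHom := hom_ext2 h0 h1
  ext x
  exact DFunLike.congr_fun this x

/-- automorphism from a pair of mutually inverse endomorphisms -/
def mkAut (u v u' v' : FreeGroup A2) (h0 : hom2 u' v' u = ga) (h1 : hom2 u' v' v = gb)
    (h2 : hom2 u v u' = ga) (h3 : hom2 u v v' = gb) : MulAut (FreeGroup A2) :=
  { toFun := hom2 u v
    invFun := hom2 u' v'
    left_inv := DFunLike.congr_fun (hom_ext2 (f := (hom2 u' v').comp (hom2 u v))
      (g := MonoidHom.id _) (by simpa using h0) (by simpa using h1))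
    right_inv := DFunLike.congr_fun (hom_ext2 (f := (hom2 u v).comp (hom2 u' v'))
      (g := MonoidHom.id _) (by simpa using h2) (by simpa using h3))
    map_mul' := map_mul _ }

/-- swap -/
def aE : MulAut (FreeGroup A2) := mkAut gb ga gb ga (by simp) (by simp) (by simp) (by simp)
/-- sign -/
def aT : MulAut (FreeGroup A2) :=
  mkAut ga⁻¹ gb ga⁻¹ gb (by simp) (by simp) (by simp) (by simp)
/-- transvection -/
def aL : MulAut (FreeGroup A2) :=
  mkAut ga (ga * gb) ga (ga⁻¹ * gb) (by simp) (by simp) (by simp) (by simp)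

@[simp] theorem aE_a : aE (FreeGroup.of 0) = gb :=
  hom2_a gb ga
@[simp] theorem aE_b : aE (FreeGroup.of 1) = ga :=
  hom2_b gb ga
@[simp] theorem aT_a : aT (FreeGroup.of 0) = ga⁻¹ :=
  hom2_a ga⁻¹ gb
@[simp] theorem aT_b : aT (FreeGroup.of 1) = gb :=
  hom2_b ga⁻¹ gb
@[simp] theorem aL_a : aL (FreeGroup.of 0) = ga :=
  hom2_a ga (ga * gb)
@[simp] theorem aL_b : aL (FreeGroup.of 1) = ga * gb :=
  hom2_b ga (ga * gb)
@[simp] theorem aLi_a : (MulEquiv.symm aL) (FreeGroup.of 0) = ga :=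
  hom2_a ga (ga⁻¹ * gb)
@[simp] theorem aLi_b : (MulEquiv.symm aL) (FreeGroup.of 1) = ga⁻¹ * gb :=
  hom2_b ga (ga⁻¹ * gb)

/-- inner automorphisms -/
abbrev Inn : Subgroup (MulAut (FreeGroup A2)) := (MulAut.conj (G := FreeGroup A2)).range

instance inn_normal : Inn.Normal := by
  constructor
  rintro _ ⟨w, rfl⟩ g
  refine ⟨g w, ?_⟩
  ext x
  simp

/-- outer automorphisms -/
abbrev Out2 := MulAut (FreeGroup A2) ⧸ Inn

/-- projection -/
abbrev pr : MulAut (FreeGroup A2) →* Out2 := QuotientGroup.mk' Inn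

theorem pr_conj (w : FreeGroup A2) : pr (MulAut.conj w) = 1 :=
  (QuotientGroup.eq_one_iff _).2 ⟨w, rfl⟩

theorem pr_eq {f g : MulAut (FreeGroup A2)} (w : FreeGroup A2) (h : f = MulAut.conj w * g) :
    pr f = pr g := by
  rw [h, map_mul, pr_conj, one_mul]

/-- the subgroup of automorphisms generated by elementary ones -/
def K : Subgroup (MulAut (FreeGroup A2)) :=
  (Subgroup.closure ({pr aE, pr aT, pr aL} : Set Out2)).comap pr

theorem E_mem : aE ∈ K := Subgroup.mem_comap.2 (Subgroup.subset_closure (by simp))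
theorem T_mem : aT ∈ K := Subgroup.mem_comap.2 (Subgroup.subset_closure (by simp))
theorem L_mem : aL ∈ K := Subgroup.mem_comap.2 (Subgroup.subset_closure (by simp))
theorem conj_mem (w : FreeGroup A2) : MulAut.conj w ∈ K := by
  refine Subgroup.mem_comap.2 ?_
  rw [pr_conj]; exact one_mem _

theorem K_sps (g : MulAut (FreeGroup A2)) (hg : g ∈ K) :
    SPS (pr aE) (pr aT) (pr aL) (pr g) := by
  refine sps_all ?_ ?_ ?_ ?_ ?_ ?_ (pr g) (Subgroup.mem_comap.1 hg)
  · rw [← map_mul, ← map_one pr]; congr 1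
    apply aut_ext2 <;> simp
  · rw [← map_mul, ← map_one pr]; congr 1
    apply aut_ext2 <;> simp
  · simp only [← map_mul]; congr 1
    apply aut_ext2 <;> simp
  · simp only [← map_mul, ← map_inv]; congr 1
    apply aut_ext2 <;> simp
  · simp only [← map_mul, ← map_inv]
    apply pr_eq ga⁻¹
    apply aut_ext2 <;> simp [mul_assoc]
  · simp only [← map_mul]
    apply pr_eq ga
    apply aut_ext2 <;> simp [mul_assoc]

/-- total length -/
def tot (f : MulAut (FreeGroup A2)) : ℕ := (f ga).norm + (f gb).norm

/-- minimal in its coset -/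
def IsMin (f : MulAut (FreeGroup A2)) : Prop := ∀ h, f⁻¹ * h ∈ K → tot f ≤ tot h

theorem exists_min (f : MulAut (FreeGroup A2)) : ∃ h, f⁻¹ * h ∈ K ∧ IsMin h := by
  have hne : ∃ n, ∃ h, f⁻¹ * h ∈ K ∧ tot h = n := ⟨_, f, by simp [one_mem], rfl⟩
  classical
  obtain ⟨h, h1, h2⟩ := Nat.find_spec hne
  refine ⟨h, h1, fun k hk => ?_⟩
  rw [h2]
  apply Nat.find_min'
  refine ⟨k, ?_, rfl⟩
  have := mul_mem h1 hk
  simpa [mul_assoc] using this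

theorem IsMin.mv {f : MulAut (FreeGroup A2)} (hf : IsMin f) (w : FreeGroup A2)
    (k : MulAut (FreeGroup A2)) (hk : k ∈ K) :
    tot f ≤ (w * f (k ga) * w⁻¹).norm + (w * f (k gb) * w⁻¹).norm := by
  have := hf (MulAut.conj w * (f * k)) (by
    have : f⁻¹ * (MulAut.conj w * (f * k)) = MulAut.conj (f⁻¹ w) * k := by
      ext x; simp
    rw [this]
    exact mul_mem (conj_mem _) hk)
  simpa [tot] using this

theorem IsMin.mv1 {f : MulAut (FreeGroup A2)} (hf : IsMin f)
    (k : MulAut (FreeGroup A2)) (hk : k ∈ K) :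
    tot f ≤ (f (k ga)).norm + (f (k gb)).norm := by
  simpa using hf.mv 1 k hk

theorem special (u v : FreeGroup A2) (hv : v ≠ 1) (hvu : v.norm ≤ (v * u).norm)
    (h1 : 2 * gp u⁻¹ v = v.norm) (h2 : 2 * gp v⁻¹ u = v.norm) :
    ∃ p : FreeGroup A2,
      (p⁻¹ * (v * u) * p).norm + (p⁻¹ * v * p).norm < u.norm + v.norm := by
  have hv0 : v.norm ≠ 0 := fun h => hv (FreeGroup.norm_eq_zero.1 h)
  obtain ⟨p, hp, hp2⟩ := exists_prefix v (gp u⁻¹ v) (by omega)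
  obtain ⟨q, hq⟩ : ∃ q, q = v⁻¹ * p := ⟨_, rfl⟩
  have hqi : q⁻¹ = p⁻¹ * v := by rw [hq]; group
  have hqn : q.norm = (p⁻¹ * v).norm := by rw [← hqi, FreeGroup.norm_inv_eq]
  refine ⟨p, ?_⟩
  have e1 : p⁻¹ * (v * u) * p = q⁻¹ * u * p := by rw [hqi]; group
  rw [e1, ← hqi]
  have a1 := gp_norm p v
  have a2 := gp_norm q v⁻¹
  have a3 := gp_norm q u
  have a4 := gp_norm (u⁻¹ * q) u⁻¹
  have a5 := gp_norm (u⁻¹ * q) p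
  have a6 := gp_norm v⁻¹ u
  have e2 : q⁻¹ * v⁻¹ = p⁻¹ := by rw [hqi]; group
  have e3 : (u⁻¹ * q)⁻¹ * u⁻¹ = q⁻¹ := by group
  have e4 : (u⁻¹ * q)⁻¹ * p = q⁻¹ * u * p := by group
  have e5 : (u⁻¹ * q).norm = (q⁻¹ * u).norm := by rw [← FreeGroup.norm_inv_eq]; congr 1; group
  rw [e2] at a2
  rw [e3] at a4
  rw [e4] at a5
  rw [inv_inv] at a6
  have b1 := gp_ultra p v u⁻¹
  have b2 := gp_ultra q v⁻¹ u
  have b3 := gp_ultra (u⁻¹ * q) u⁻¹ p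
  have c1 := gp_comm v u⁻¹
  have c2 := gp_comm u⁻¹ p
  have d1 := FreeGroup.norm_mul_le q⁻¹ p
  have d2 := FreeGroup.norm_mul_le q (q⁻¹ * u)
  rw [mul_inv_cancel_left] at d2
  simp only [FreeGroup.norm_inv_eq] at *
  omega

theorem core (f : MulAut (FreeGroup A2)) (hf : IsMin f) (x z : FreeGroup A2)
    (hx : x = f ga ∨ x = (f ga)⁻¹ ∨ x = f gb) (hz : z = f ga ∨ z = (f ga)⁻¹ ∨ z = f gb) :
    gp x⁻¹ (f gb) + gp (f gb)⁻¹ z < (f gb).norm := by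
  have hN : aE * aL * aE ∈ K := mul_mem (mul_mem E_mem L_mem) E_mem
  have hN' : aE * aL⁻¹ * aE ∈ K := mul_mem (mul_mem E_mem (inv_mem L_mem)) E_mem
  have m1 := hf.mv1 _ hN
  have m2 := hf.mv1 _ hN'
  have m3 := hf.mv1 _ (mul_mem (conj_mem gb⁻¹) hN)
  have m4 := hf.mv1 _ (mul_mem (conj_mem gb) hN')
  have m5 := hf.mv1 _ (mul_mem (conj_mem ga⁻¹) L_mem)
  have m6 := hf.mv1 _ (mul_mem (conj_mem ga) (inv_mem L_mem))
  have s1 := fun w => hf.mv w _ hN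
  have s2 := fun w => hf.mv w _ (mul_mem T_mem hN)
  have hv : f gb ≠ 1 := by
    intro h
    rw [← map_one f] at h
    exact FreeGroup.of_ne_one _ (f.injective h)
  simp [tot, mul_assoc] at m1 m2 m3 m4 m5 m6 s1 s2
  change _ ≠ _ at hv
  generalize f (FreeGroup.of 0) = u at *
  generalize f (FreeGroup.of 1) = v at *
  have q0 := gp_self_lt v hv
  have q1 := gp_norm u⁻¹ v
  have q2 := gp_norm u v
  have q3 := gp_norm v⁻¹ u
  have q4 := gp_norm v⁻¹ u⁻¹
  have r1 : (u⁻¹ * v).norm = (v⁻¹ * u).norm := by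
    rw [← FreeGroup.norm_inv_eq]; congr 1; group
  have r2 : (v * u⁻¹).norm = (u * v⁻¹).norm := by
    rw [← FreeGroup.norm_inv_eq]; congr 1; group
  have t1 := gp_ultra v⁻¹ u⁻¹ v
  have t2 := gp_ultra v⁻¹ u v
  simp only [FreeGroup.norm_inv_eq, inv_inv] at q1 q2 q3 q4
  rcases hx with hx | hx | hx <;> rcases hz with hz | hz | hz <;>
    simp only [hx, hz, inv_inv] <;> try omega
  · by_contra hcon
    obtain ⟨p, hp⟩ := special u v hv (by omega) (by omega) (by omega)
    have := s1 p⁻¹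
    simp only [inv_inv, mul_assoc] at this hp
    omega
  · by_contra hcon
    obtain ⟨p, hp⟩ := special u⁻¹ v hv (by omega) (by rw [inv_inv]; omega) (by omega)
    have := s2 p⁻¹
    simp only [inv_inv, mul_assoc, FreeGroup.norm_inv_eq] at this hp
    omega

end NielsenF2
namespace NielsenF2

theorem mk_true (i : A2) : FreeGroup.mk [(i, true)] = FreeGroup.of i := rfl
theorem mk_false (i : A2) : FreeGroup.mk [(i, false)] = (FreeGroup.of i)⁻¹ := rfl

theorem exists_perm (s t : A2 × Bool) (h : s.1 ≠ t.1) :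
    ∃ k ∈ K, k ga = FreeGroup.mk [s] ∧ k gb = FreeGroup.mk [t] := by
  obtain ⟨i, x⟩ := s
  obtain ⟨j, y⟩ := t
  have hE := E_mem
  have hT := T_mem
  fin_cases i <;> fin_cases j <;> simp at h <;> cases x <;> cases y
  · exact ⟨aT * (aE * aT * aE), mul_mem hT (mul_mem (mul_mem hE hT) hE),
      by simp [mk_false], by simp [mk_false]⟩
  · exact ⟨aT, hT, by simp [mk_false], by simp [mk_true]⟩
  · exact ⟨aE * aT * aE, mul_mem (mul_mem hE hT) hE,
      by simp [mk_true], by simp [mk_false]⟩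
  · exact ⟨1, one_mem _, by simp [mk_true], by simp [mk_true]⟩
  · exact ⟨aE * (aT * (aE * aT * aE)), mul_mem hE (mul_mem hT (mul_mem (mul_mem hE hT) hE)),
      by simp [mk_false], by simp [mk_false]⟩
  · exact ⟨aE * aT, mul_mem hE hT, by simp [mk_false], by simp [mk_true]⟩
  · exact ⟨aT * aE, mul_mem hT hE, by simp [mk_true], by simp [mk_false]⟩
  · exact ⟨aE, hE, by simp [mk_true], by simp [mk_true]⟩

theorem IsMin.local {f : MulAut (FreeGroup A2)} (hf : IsMin f) (s t r : A2 × Bool)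
    (hst : s.1 = t.1 → s.2 = t.2) (htr : t.1 = r.1 → t.2 = r.2) :
    gp (f (FreeGroup.mk [s]))⁻¹ (f (FreeGroup.mk [t])) +
      gp (f (FreeGroup.mk [t]))⁻¹ (f (FreeGroup.mk [r])) < (f (FreeGroup.mk [t])).norm := by
  obtain ⟨o, ho⟩ : ∃ o : A2 × Bool, o.1 ≠ t.1 := by
    refine ⟨(t.1 + 1, true), ?_⟩
    obtain ⟨i, x⟩ := t
    fin_cases i <;> simp
  obtain ⟨k, hk, ka, kb⟩ := exists_perm o t ho
  have htot : tot (f * k) = tot f := by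
    simp only [tot, MulAut.mul_apply, ka, kb]
    obtain ⟨i, x⟩ := o
    obtain ⟨j, y⟩ := t
    fin_cases i <;> fin_cases j <;> simp at ho <;> cases x <;> cases y <;>
      simp [mk_true, mk_false, add_comm]
  have hmin : IsMin (f * k) := by
    intro h hh
    rw [htot]
    apply hf
    have := mul_mem hk hh
    simpa [mul_assoc] using this
  have hc := core (f * k) hmin (f (FreeGroup.mk [s])) (f (FreeGroup.mk [r]))
  simp only [MulAut.mul_apply, ka, kb] at hc
  apply hc
  · obtain ⟨i, x⟩ := o
    obtain ⟨j, y⟩ := t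
    obtain ⟨l, z⟩ := s
    fin_cases i <;> fin_cases j <;> simp at ho <;> fin_cases l <;> cases x <;> cases y <;>
      cases z <;> simp at hst <;>
      simp [mk_true, mk_false]
  · obtain ⟨i, x⟩ := o
    obtain ⟨j, y⟩ := t
    obtain ⟨l, z⟩ := r
    fin_cases i <;> fin_cases j <;> simp at ho <;> fin_cases l <;> cases x <;> cases y <;>
      cases z <;> simp at htr <;>
      simp [mk_true, mk_false]

theorem IsMin.letter {f : MulAut (FreeGroup A2)} (hf : IsMin f) (i : A2) :
    ∃ s : A2 × Bool, f (FreeGroup.mk [s]) = FreeGroup.of i := by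
  obtain ⟨x, hx⟩ := f.surjective (FreeGroup.of i)
  have hx1 : x ≠ 1 := by
    rintro rfl
    rw [map_one] at hx
    exact FreeGroup.one_ne_of i hx
  have hred : FreeGroup.IsReduced x.toWord := FreeGroup.isReduced_toWord
  have hxx : FreeGroup.mk x.toWord = x := FreeGroup.mk_toWord
  cases hw : x.toWord with
  | nil => exact absurd (FreeGroup.toWord_eq_nil_iff.1 hw) hx1
  | cons s L =>
    rw [hw] at hred hxx
    have hr2 : FreeGroup.IsReduced (s :: s :: L) := by
      unfold FreeGroup.IsReduced at *
      rw [List.isChain_cons_cons]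
      exact ⟨fun _ => rfl, hred⟩
    have hg := (growth f.toMonoidHom (fun s t r h1 h2 => hf.local s t r h1 h2) L s s hr2).2
    have e : f.toMonoidHom (FreeGroup.mk (s :: L)) = FreeGroup.of i := by
      rw [hxx]; exact hx
    rw [e, FreeGroup.norm_of] at hg
    have hL : L = [] := List.length_eq_zero_iff.1 (by omega)
    subst hL
    exact ⟨s, e⟩

theorem IsMin.mem {f : MulAut (FreeGroup A2)} (hf : IsMin f) : f ∈ K := by
  obtain ⟨s, hs⟩ := hf.letter 0
  obtain ⟨t, ht⟩ := hf.letter 1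
  have hst : s.1 ≠ t.1 := by
    intro h
    have hd : f (FreeGroup.mk [s]) = f (FreeGroup.mk [t]) ∨
        f (FreeGroup.mk [s]) = (f (FreeGroup.mk [t]))⁻¹ := by
      obtain ⟨i, x⟩ := s
      obtain ⟨j, y⟩ := t
      simp only at h
      subst h
      cases x <;> cases y <;> simp [mk_true, mk_false]
    rw [hs, ht] at hd
    revert hd
    decide
  obtain ⟨k, hk, ka, kb⟩ := exists_perm s t hst
  have : f * k = 1 := by
    apply aut_ext2
    · simp only [MulAut.mul_apply, ka, hs]; rfl
    · simp only [MulAut.mul_apply, kb, ht]; rfl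
  rw [mul_eq_one_iff_eq_inv.1 this]
  exact inv_mem hk

theorem K_top (f : MulAut (FreeGroup A2)) : f ∈ K := by
  obtain ⟨h, h1, h2⟩ := exists_min f
  have := mul_mem h2.mem (inv_mem h1)
  simpa using this

/-- positive elements -/
abbrev Pos : Submonoid (FreeGroup A2) := Submonoid.closure (Set.range FreeGroup.of)

/-- integer exponent sum -/
def ex (i : A2) (x : FreeGroup A2) : ℤ := Multiplicative.toAdd (TwoSubst.expSum i x)

theorem ex_mul (i : A2) (x y : FreeGroup A2) : ex i (x * y) = ex i x + ex i y := by
  simp [ex]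
theorem ex_inv (i : A2) (x : FreeGroup A2) : ex i x⁻¹ = - ex i x := by
  simp [ex]
theorem ex_one (i : A2) : ex i 1 = 0 := by simp [ex]
theorem ex_of (i j : A2) : ex i (FreeGroup.of j) = if j = i then 1 else 0 := by
  simp [ex, TwoSubst.expSum]

theorem pos_ex (x : FreeGroup A2) (hx : x ∈ Pos) :
    0 ≤ ex 0 x ∧ 0 ≤ ex 1 x ∧ (ex 0 x + ex 1 x = 0 → x = 1) ∧
    (ex 0 x + ex 1 x = 1 → ∃ j, x = FreeGroup.of j) := by
  induction hx using Submonoid.closure_induction_left with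
  | one => simp [ex_one]
  | mul_left y hy z hz ih =>
    obtain ⟨j, rfl⟩ := hy
    obtain ⟨h0, h1, h2, h3⟩ := ih
    have hj : ex 0 (FreeGroup.of j) + ex 1 (FreeGroup.of j) = 1 ∧
        0 ≤ ex 0 (FreeGroup.of j) ∧ 0 ≤ ex 1 (FreeGroup.of j) := by
      fin_cases j <;> simp [ex_of]
    simp only [ex_mul]
    refine ⟨by omega, by omega, by omega, fun h => ⟨j, ?_⟩⟩
    rw [h2 (by omega), mul_one]

theorem pos_map (p : MulAut (FreeGroup A2)) (hp : p ∈ Submonoid.closure {aE, aL}) :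
    ∀ x ∈ Pos, p x ∈ Pos := by
  have ha : ga ∈ Pos := Submonoid.subset_closure ⟨0, rfl⟩
  have hb : gb ∈ Pos := Submonoid.subset_closure ⟨1, rfl⟩
  have key : ∀ q : MulAut (FreeGroup A2), q ga ∈ Pos → q gb ∈ Pos → ∀ x ∈ Pos, q x ∈ Pos := by
    intro q h0 h1 x hx
    induction hx using Submonoid.closure_induction with
    | mem x hx =>
      obtain ⟨i, rfl⟩ := hx
      fin_cases i
      · exact h0
      · exact h1
    | one => rw [map_one]; exact one_mem _
    | mul x y _ _ hx hy => rw [map_mul]; exact mul_mem hx hy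
  induction hp using Submonoid.closure_induction with
  | mem q hq =>
    rcases hq with rfl | rfl
    · exact key _ (by simpa using hb) (by simpa using ha)
    · exact key _ (by simpa using ha) (by simpa using mul_mem ha hb)
  | one => intro x hx; exact hx
  | mul p q _ _ hp hq => intro x hx; exact hp _ (hq x hx)

/-- sign automorphisms -/
theorem sign_lift (x : Out2) (hx : IsSign (pr aE) (pr aT) x) :
    ∃ s : MulAut (FreeGroup A2), pr s = x ∧ ∃ m n : ℤ, (m = 1 ∨ m = -1) ∧ (n = 1 ∨ n = -1) ∧
      s ga = ga ^ m ∧ s gb = gb ^ n := by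
  rcases hx with rfl | rfl | rfl | rfl
  · exact ⟨1, map_one _, 1, 1, by simp⟩
  · exact ⟨aT, rfl, -1, 1, by simp⟩
  · exact ⟨aE * aT * aE, rfl, 1, -1, by simp⟩
  · exact ⟨aT * (aE * aT * aE), rfl, -1, -1, by simp⟩

theorem ex_zpow (i : A2) (x : FreeGroup A2) (n : ℤ) : ex i (x ^ n) = n * ex i x := by
  simp [ex]

theorem ex_sign (s : MulAut (FreeGroup A2)) (m n : ℤ) (h0 : s ga = ga ^ m) (h1 : s gb = gb ^ n)
    (x : FreeGroup A2) : ex 0 (s x) = m * ex 0 x ∧ ex 1 (s x) = n * ex 1 x := by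
  induction x using FreeGroup.induction_on with
  | C1 => simp [ex_one]
  | of i =>
    fin_cases i
    · simp [ex_zpow, ex_of, h0]
    · simp [ex_zpow, ex_of, h1]
  | inv_of i h => rw [map_inv, ex_inv, ex_inv, ex_inv, ex_inv, h.1, h.2]; constructor <;> ring
  | mul x y hx hy =>
    rw [map_mul, ex_mul, ex_mul, ex_mul, ex_mul, hx.1, hx.2, hy.1, hy.2]; constructor <;> ring

theorem ker_inner (g : MulAut (FreeGroup A2)) (hg : ∀ i x, ex i (g x) = ex i x) :
    ∃ w : FreeGroup A2, g = MulAut.conj w := by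
  obtain ⟨s, p, r, hs, hp, hr, h⟩ := K_sps g (K_top g)
  obtain ⟨S, rfl, m, n, hm, hn, S0, S1⟩ := sign_lift s hs
  obtain ⟨R, rfl, m', n', hm', hn', R0, R1⟩ := sign_lift r hr
  have : ({pr aE, pr aL} : Set Out2) = pr '' {aE, aL} := by rw [Set.image_pair]
  rw [this, ← MonoidHom.map_mclosure] at hp
  obtain ⟨P, hP, rfl⟩ := hp
  rw [← map_mul, ← map_mul] at h
  have hq : (S * P * R) ⁻¹ * g ∈ Inn := QuotientGroup.eq.1 h.symm
  obtain ⟨w, hw⟩ := hq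
  have hgw : g = S * P * R * MulAut.conj w := by rw [hw]; group
  have hk : ∀ i x, ex i (S (P (R x))) = ex i x := by
    intro i x
    have h1 : S (P (R x)) = g (w⁻¹ * x * w) := by
      rw [hgw]; simp [mul_assoc]
    rw [h1, hg, ex_mul, ex_mul, ex_inv]; ring
  have hPos := pos_map P hP
  have ha : ga ∈ Pos := Submonoid.subset_closure ⟨0, rfl⟩
  have hb : gb ∈ Pos := Submonoid.subset_closure ⟨1, rfl⟩
  obtain ⟨a1, a2, -, a4⟩ := pos_ex _ (hPos _ ha)
  obtain ⟨b1, b2, -, b4⟩ := pos_ex _ (hPos _ hb)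
  have k1 := hk 0 ga
  have k2 := hk 1 ga
  have k3 := hk 0 gb
  have k4 := hk 1 gb
  rw [R0] at k1 k2
  rw [R1] at k3 k4
  rw [(ex_sign S m n S0 S1 _).1, map_zpow, ex_zpow, ex_of] at k1 k3
  rw [(ex_sign S m n S0 S1 _).2, map_zpow, ex_zpow, ex_of] at k2 k4
  simp at k1 k2 k3 k4
  have A : ex 0 (P ga) = 1 ∧ ex 1 (P ga) = 0 ∧ m = m' := by
    rcases hm with rfl | rfl <;> rcases hn with rfl | rfl <;> rcases hm' with rfl | rfl <;>
      simp at k1 k2 <;> omega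
  have B : ex 0 (P gb) = 0 ∧ ex 1 (P gb) = 1 ∧ n = n' := by
    rcases hm with rfl | rfl <;> rcases hn with rfl | rfl <;> rcases hn' with rfl | rfl <;>
      simp at k3 k4 <;> omega
  obtain ⟨A1, A2, rfl⟩ := A
  obtain ⟨B1, B2, rfl⟩ := B
  have P0 : P ga = ga := by
    obtain ⟨j, hj⟩ := a4 (by omega)
    rw [hj] at A1 ⊢
    rw [ex_of] at A1
    fin_cases j <;> simp at A1 ⊢
  have P1 : P gb = gb := by
    obtain ⟨j, hj⟩ := b4 (by omega)
    rw [hj] at B2 ⊢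
    rw [ex_of] at B2
    fin_cases j <;> simp at B2 ⊢
  refine ⟨w, ?_⟩
  have : S * P * R = 1 := by
    apply aut_ext2
    · simp only [MulAut.mul_apply, R0, map_zpow, P0, S0]
      rcases hm with rfl | rfl <;> simp
    · simp only [MulAut.mul_apply, R1, map_zpow, P1, S1]
      rcases hn with rfl | rfl <;> simp
  rw [hgw, this, one_mul]

end NielsenF2

open TwoSubst in
/-- **Nielsen.** Two automorphisms of the free group `F₂` have the same
abelianised matrix if and only if they differ by an inner automorphism:
`σ = γ_w ∘ ρ` for some `w ∈ F₂`. -/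
theorem nielsen_abelMatrix (σ ρ : Monoid.End (FreeGroup A2))
    (hσ : Function.Bijective σ) (hρ : Function.Bijective ρ) :
    abelMatrix σ = abelMatrix ρ ↔ ∃ w : FreeGroup A2, ∀ x, σ x = w * ρ x * w⁻¹ := by
  constructor
  · intro h
    have hex : ∀ i x, NielsenF2.ex i (σ x) = NielsenF2.ex i (ρ x) := by
      intro i x
      have h1 : (expSum i).comp σ = (expSum i).comp ρ := by
        ext j
        exact congrFun (congrFun h i) j
      exact congrArg Multiplicative.toAdd (DFunLike.congr_fun h1 x)
    let S : MulAut (FreeGroup A2) := MulEquiv.ofBijective σ hσ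
    let R : MulAut (FreeGroup A2) := MulEquiv.ofBijective ρ hρ
    have hS : ∀ x, S x = σ x := fun x => rfl
    have hR : ∀ x, R x = ρ x := fun x => rfl
    obtain ⟨w, hw⟩ := NielsenF2.ker_inner (S * R⁻¹) (by
      intro i x
      rw [MulAut.mul_apply, hS, hex, ← hR, MulAut.apply_inv_self])
    refine ⟨w, fun x => ?_⟩
    have := DFunLike.congr_fun hw (R x)
    rw [MulAut.mul_apply, MulAut.inv_apply_self] at this
    exact this
  · rintro ⟨w, hw⟩
    ext i j
    simp only [abelMatrix, hw, map_mul, map_inv]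
    simp
end
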